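/- Let m, n be positive integers with n ≥ 2m and B_1 the open unit ball in ℝ^n, and let φ be the fundamental solution of (−Δ)^m in ℝ^n (φ(x) = c|x|^{2m−n} if n > 2m, φ(x) = c ln(5/|x|) if n = 2m, c = c(m,n) > 0). Suppose u ∈ C^{2m}(B_1 \ {0}) satisfies (−Δ)^m u = 0 in B_1 \ {0} and ∫_{B_1 \ {0}} u^+(x) dx < ∞, where u^+ = max{u, 0}. Then there exist real constants a_β for |β| ≤ 2m−1 and a function h ∈ C^∞(B_1) with (−Δ)^m h = 0 in B_1 such that u(x) = h(x) + Σ_{|β| ≤ 2m−1} a_β D^β φ(x) for all x ∈ B_1 \ {0}. -/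

import Mathlib

open MeasureTheory Metric Real Set
open scoped ENNReal NNReal

noncomputable section

/-- First-order partial derivative in direction `i`. -/
def pderiv1 {n : ℕ} (i : Fin n) (f : EuclideanSpace ℝ (Fin n) → ℝ) :
    EuclideanSpace ℝ (Fin n) → ℝ :=
  fun x => fderiv ℝ f x (EuclideanSpace.single i 1)

/-- The Laplacian `Δf = ∑ ∂²f/∂xᵢ²`. -/
def lap {n : ℕ} (f : EuclideanSpace ℝ (Fin n) → ℝ) : EuclideanSpace ℝ (Fin n) → ℝ :=
  fun x => ∑ i, pderiv1 i (pderiv1 i f) x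

/-- The negative Laplacian `-Δ`. -/
def nlap {n : ℕ} (f : EuclideanSpace ℝ (Fin n) → ℝ) : EuclideanSpace ℝ (Fin n) → ℝ :=
  fun x => -(lap f x)

/-- `(-Δ)^m`, the m-th iterate of the negative Laplacian. -/
def nlapIter {n : ℕ} (m : ℕ) (f : EuclideanSpace ℝ (Fin n) → ℝ) :
    EuclideanSpace ℝ (Fin n) → ℝ :=
  nlap^[m] f

/-- `D^β`, the mixed partial derivative associated to a multi-index `β`. -/
def mderiv {n : ℕ} (β : Fin n → ℕ) (f : EuclideanSpace ℝ (Fin n) → ℝ) :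
    EuclideanSpace ℝ (Fin n) → ℝ :=
  ((List.finRange n).foldr (fun i F => F ∘ (pderiv1 i)^[β i]) id) f

/-- The finset of multi-indices `β` with `|β| ≤ s`. -/
def degLE (n s : ℕ) : Finset (Fin n → ℕ) :=
  (Fintype.piFinset fun _ : Fin n => Finset.range (s+1)).filter fun β => ∑ i, β i ≤ s

/-- The finset of multi-indices `β` with `|β| < s` (i.e. `|β| ≤ s - 1`; empty for `s = 0`). -/
def degLT (n s : ℕ) : Finset (Fin n → ℕ) :=
  (Fintype.piFinset fun _ : Fin n => Finset.range s).filter fun β => ∑ i, β i < s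

/-- Fundamental-solution profile of `(-Δ)^m` on `ℝⁿ`:
`c‖x‖^{2m-n}` for `n > 2m` and `c ln(5/‖x‖)` for `n = 2m`. -/
def fundSol (m n : ℕ) (c : ℝ) : EuclideanSpace ℝ (Fin n) → ℝ :=
  fun x => if n = 2*m then c * Real.log (5 / ‖x‖) else c * ‖x‖ ^ ((2*m : ℤ) - n)

/-- `ψ(x,y) = φ(x-y) - ∑_{|β| ≤ s-1} ((-y)^β/β!) D^β φ(x)`. -/
def psiFun (m n s : ℕ) (c : ℝ) (x y : EuclideanSpace ℝ (Fin n)) : ℝ :=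
  fundSol m n c (x - y) -
    ∑ β ∈ degLT n s,
      ((∏ i, (-(y i)) ^ β i) / ∏ i, ((β i).factorial : ℝ)) * mderiv β (fundSol m n c) x

/-- `N(x) = ∫_{|y| ≤ 1} ψ(x,y) f(y) dy`. -/
def NFun (m n s : ℕ) (c : ℝ) (f : EuclideanSpace ℝ (Fin n) → ℝ)
    (x : EuclideanSpace ℝ (Fin n)) : ℝ :=
  ∫ y in closedBall (0 : EuclideanSpace ℝ (Fin n)) 1, psiFun m n s c x y * f y

section Preliminaries

variable {n : ℕ}

local notation "𝔼" => EuclideanSpace ℝ (Fin n)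

theorem pderiv1_eqOn {U : Set 𝔼} (hU : IsOpen U) {f g : 𝔼 → ℝ} (h : EqOn f g U) (i : Fin n) :
    EqOn (pderiv1 i f) (pderiv1 i g) U := by
  intro x hx
  have : f =ᶠ[nhds x] g := h.eventuallyEq_of_mem (hU.mem_nhds hx)
  simp only [pderiv1, this.fderiv_eq]

theorem pderiv1_contDiffOn {U : Set 𝔼} (hU : IsOpen U) {k l : WithTop ℕ∞} {f : 𝔼 → ℝ}
    (hf : ContDiffOn ℝ l f U) (h : k + 1 ≤ l) (i : Fin n) : ContDiffOn ℝ k (pderiv1 i f) U :=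
  (hf.fderiv_of_isOpen hU h).clm_apply contDiffOn_const

theorem pderiv1_contDiff {k l : WithTop ℕ∞} {f : 𝔼 → ℝ}
    (hf : ContDiff ℝ l f) (h : k + 1 ≤ l) (i : Fin n) : ContDiff ℝ k (pderiv1 i f) :=
  contDiffOn_univ.1 (pderiv1_contDiffOn isOpen_univ (contDiffOn_univ.2 hf) h i)

theorem pderiv1_const_mul {f : 𝔼 → ℝ} (a : ℝ) (i : Fin n) :
    pderiv1 i (fun y => a * f y) = fun y => a * pderiv1 i f y := by
  funext x
  have h2 : (fun y => a * f y) = a • f := by ext; simp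
  simp only [pderiv1]
  rw [h2, fderiv_const_smul_field]; simp

theorem pderiv1_neg {f : 𝔼 → ℝ} (i : Fin n) :
    pderiv1 i (fun y => -f y) = fun y => -pderiv1 i f y := by
  simpa using pderiv1_const_mul (f := f) (-1) i

theorem pderiv1_add {f g : 𝔼 → ℝ} {x : 𝔼} (hf : DifferentiableAt ℝ f x)
    (hg : DifferentiableAt ℝ g x) (i : Fin n) :
    pderiv1 i (fun y => f y + g y) x = pderiv1 i f x + pderiv1 i g x := by
  simp only [pderiv1]
  rw [fderiv_fun_add hf hg]; simp

theorem pderiv1_sub {f g : 𝔼 → ℝ} {x : 𝔼} (hf : DifferentiableAt ℝ f x)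
    (hg : DifferentiableAt ℝ g x) (i : Fin n) :
    pderiv1 i (fun y => f y - g y) x = pderiv1 i f x - pderiv1 i g x := by
  simp only [pderiv1]
  rw [fderiv_fun_sub hf hg]; simp

theorem pderiv1_mul {f g : 𝔼 → ℝ} {x : 𝔼} (hf : DifferentiableAt ℝ f x)
    (hg : DifferentiableAt ℝ g x) (i : Fin n) :
    pderiv1 i (fun y => f y * g y) x = pderiv1 i f x * g x + f x * pderiv1 i g x := by
  simp only [pderiv1]
  rw [fderiv_fun_mul hf hg]; simp; ring

theorem pderiv1_sum {ι : Type*} {s : Finset ι} {f : ι → 𝔼 → ℝ} {x : 𝔼}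
    (hf : ∀ j ∈ s, DifferentiableAt ℝ (f j) x) (i : Fin n) :
    pderiv1 i (fun y => ∑ j ∈ s, f j y) x = ∑ j ∈ s, pderiv1 i (f j) x := by
  simp only [pderiv1]
  rw [fderiv_fun_sum hf]; simp

theorem pderiv1_const_sub_comp (f : 𝔼 → ℝ) (x : 𝔼) (i : Fin n) :
    pderiv1 i (fun y => f (x - y)) = fun y => -pderiv1 i f (x - y) := by
  funext y
  simp only [pderiv1]
  have h1 : (fun y => f (x - y)) = fun y => (fun z => f (-z)) (y - x) := by
    funext z; simp
  have h2 : (fun z => f (-z)) = f ∘ (ContinuousLinearEquiv.neg ℝ : 𝔼 ≃L[ℝ] 𝔼) := rfl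
  rw [h1, fderiv_comp_sub (f := fun z => f (-z)), h2, ContinuousLinearEquiv.comp_right_fderiv]
  simp

theorem pderiv1_coord (i j : Fin n) (x : 𝔼) :
    pderiv1 i (fun y : 𝔼 => y j) x = if i = j then 1 else 0 := by
  have : HasFDerivAt (fun y : 𝔼 => y j) (EuclideanSpace.proj (𝕜 := ℝ) j : 𝔼 →L[ℝ] ℝ) x :=
    (EuclideanSpace.proj (𝕜 := ℝ) j : 𝔼 →L[ℝ] ℝ).hasFDerivAt
  simp only [pderiv1, this.fderiv]
  simp [eq_comm]

theorem pderiv1_comm {U : Set 𝔼} (hU : IsOpen U) {f : 𝔼 → ℝ}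
    (hf : ContDiffOn ℝ 2 f U) (i j : Fin n) :
    EqOn (pderiv1 i (pderiv1 j f)) (pderiv1 j (pderiv1 i f)) U := by
  intro x hx
  have hfx : ContDiffAt ℝ 2 f x := hf.contDiffAt (hU.mem_nhds hx)
  have hd : DifferentiableAt ℝ (fderiv ℝ f) x :=
    (hfx.fderiv_right (m := 1) (by norm_num)).differentiableAt (by norm_num)
  have key : ∀ i j : Fin n, pderiv1 i (pderiv1 j f) x
      = fderiv ℝ (fderiv ℝ f) x (EuclideanSpace.single i 1) (EuclideanSpace.single j 1) := by
    intro i j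
    have : pderiv1 j f = fun y => (fderiv ℝ f y) (EuclideanSpace.single j 1) := rfl
    rw [this]
    simp only [pderiv1]
    rw [fderiv_clm_apply hd (by fun_prop)]
    simp
  rw [key, key]
  exact (hfx.isSymmSndFDerivAt (by simp)) _ _

theorem tsupport_pderiv1_subset (f : 𝔼 → ℝ) (i : Fin n) :
    tsupport (pderiv1 i f) ⊆ tsupport f := by
  refine closure_minimal ?_ (isClosed_tsupport f)
  intro x hx
  by_contra h
  have : f =ᶠ[nhds x] 0 := notMem_tsupport_iff_eventuallyEq.1 h
  apply hx
  simp only [pderiv1, this.fderiv_eq]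
  simp

theorem lap_eqOn {U : Set 𝔼} (hU : IsOpen U) {f g : 𝔼 → ℝ} (h : EqOn f g U) :
    EqOn (lap f) (lap g) U := by
  intro x hx
  simp only [lap]
  exact Finset.sum_congr rfl fun i _ => pderiv1_eqOn hU (pderiv1_eqOn hU h i) i hx

theorem nlap_eqOn {U : Set 𝔼} (hU : IsOpen U) {f g : 𝔼 → ℝ} (h : EqOn f g U) :
    EqOn (nlap f) (nlap g) U := by
  intro x hx
  simp only [nlap, lap_eqOn hU h hx]

theorem nlapIter_succ (k : ℕ) (f : 𝔼 → ℝ) : nlapIter (k + 1) f = nlap (nlapIter k f) := by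
  simp only [nlapIter, Function.iterate_succ_apply']

theorem nlapIter_succ' (k : ℕ) (f : 𝔼 → ℝ) : nlapIter (k + 1) f = nlapIter k (nlap f) := by
  simp only [nlapIter, Function.iterate_succ_apply]

theorem nlapIter_eqOn {U : Set 𝔼} (hU : IsOpen U) {f g : 𝔼 → ℝ} (h : EqOn f g U) (k : ℕ) :
    EqOn (nlapIter k f) (nlapIter k g) U := by
  induction k with
  | zero => simpa [nlapIter] using h
  | succ k ih => rw [nlapIter_succ, nlapIter_succ]; exact nlap_eqOn hU ih

theorem nlap_contDiffOn {U : Set 𝔼} (hU : IsOpen U) {k l : WithTop ℕ∞} {f : 𝔼 → ℝ}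
    (hf : ContDiffOn ℝ l f U) (h : k + 2 ≤ l) : ContDiffOn ℝ k (nlap f) U := by
  unfold nlap lap
  refine (ContDiffOn.sum fun i _ => ?_).neg
  have h2 : k + 1 + 1 ≤ l := by rwa [add_assoc, one_add_one_eq_two]
  exact pderiv1_contDiffOn hU (pderiv1_contDiffOn hU hf h2 i) le_rfl i

theorem nlapIter_contDiffOn {U : Set 𝔼} (hU : IsOpen U) {k : ℕ} (j : ℕ) {f : 𝔼 → ℝ}
    (hf : ContDiffOn ℝ (k + 2 * j : ℕ) f U) : ContDiffOn ℝ k (nlapIter j f) U := by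
  induction j generalizing k with
  | zero => simpa [nlapIter] using hf
  | succ j ih =>
    rw [nlapIter_succ]
    refine nlap_contDiffOn hU (ih (k := k + 2) ?_) (by norm_cast)
    convert hf using 2
    ring_nf

theorem nlapIter_contDiff {k : ℕ} (j : ℕ) {f : 𝔼 → ℝ}
    (hf : ContDiff ℝ (k + 2 * j : ℕ) f) : ContDiff ℝ k (nlapIter j f) :=
  contDiffOn_univ.1 (nlapIter_contDiffOn isOpen_univ j (contDiffOn_univ.2 hf))

theorem nlapIter_contDiffOn_infty {U : Set 𝔼} (hU : IsOpen U) (j : ℕ) {f : 𝔼 → ℝ}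
    (hf : ContDiffOn ℝ (⊤ : ℕ∞) f U) : ContDiffOn ℝ (⊤ : ℕ∞) (nlapIter j f) U := by
  induction j with
  | zero => simpa [nlapIter] using hf
  | succ j ih =>
    rw [nlapIter_succ]
    exact nlap_contDiffOn hU ih le_rfl

theorem tsupport_nlap_subset (f : 𝔼 → ℝ) : tsupport (nlap f) ⊆ tsupport f := by
  refine closure_minimal ?_ (isClosed_tsupport f)
  intro x hx
  by_contra h
  apply hx
  have h0 : ∀ i, pderiv1 i (pderiv1 i f) x = 0 := fun i => by
    have : x ∉ tsupport (pderiv1 i (pderiv1 i f)) := fun hh =>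
      h (tsupport_pderiv1_subset _ _ (tsupport_pderiv1_subset _ _ hh))
    exact image_eq_zero_of_notMem_tsupport this
  simp [nlap, lap, h0]

theorem tsupport_nlapIter_subset (j : ℕ) (f : 𝔼 → ℝ) :
    tsupport (nlapIter j f) ⊆ tsupport f := by
  induction j with
  | zero => simp [nlapIter]
  | succ j ih => rw [nlapIter_succ]; exact (tsupport_nlap_subset _).trans ih

theorem hasCompactSupport_nlapIter (j : ℕ) {f : 𝔼 → ℝ} (hf : HasCompactSupport f) :
    HasCompactSupport (nlapIter j f) :=
  hf.of_isClosed_subset (isClosed_tsupport _) (tsupport_nlapIter_subset j f)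

theorem nlap_const_sub_comp (f : 𝔼 → ℝ) (x : 𝔼) :
    nlap (fun y => f (x - y)) = fun y => nlap f (x - y) := by
  funext y
  simp only [nlap, lap]
  congr 1
  refine Finset.sum_congr rfl fun i _ => ?_
  rw [pderiv1_const_sub_comp, pderiv1_neg, pderiv1_const_sub_comp]
  simp

theorem nlapIter_const_sub_comp (j : ℕ) (f : 𝔼 → ℝ) (x : 𝔼) :
    nlapIter j (fun y => f (x - y)) = fun y => nlapIter j f (x - y) := by
  induction j with
  | zero => rfl
  | succ j ih => rw [nlapIter_succ, ih, nlap_const_sub_comp, nlapIter_succ]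

theorem nlap_const_mul (f : 𝔼 → ℝ) (a : ℝ) :
    nlap (fun y => a * f y) = fun y => a * nlap f y := by
  funext y
  simp only [nlap, lap, pderiv1_const_mul, ← Finset.mul_sum]
  ring

theorem nlapIter_const_mul (j : ℕ) (f : 𝔼 → ℝ) (a : ℝ) :
    nlapIter j (fun y => a * f y) = fun y => a * nlapIter j f y := by
  induction j with
  | zero => rfl
  | succ j ih => rw [nlapIter_succ, ih, nlap_const_mul, nlapIter_succ]

theorem nlap_sub {U : Set 𝔼} (hU : IsOpen U) {f g : 𝔼 → ℝ} (hf : ContDiffOn ℝ 2 f U)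
    (hg : ContDiffOn ℝ 2 g U) :
    EqOn (nlap fun y => f y - g y) (fun y => nlap f y - nlap g y) U := by
  intro x hx
  have hd : ∀ {f : 𝔼 → ℝ} {k : WithTop ℕ∞} {z : 𝔼}, z ∈ U → ContDiffOn ℝ k f U → 1 ≤ k →
      DifferentiableAt ℝ f z :=
    fun hz h hk => (h.contDiffAt (hU.mem_nhds hz)).differentiableAt (by
      rintro rfl; simp at hk)
  have hp : ∀ i {f : 𝔼 → ℝ}, ContDiffOn ℝ 2 f U → ContDiffOn ℝ 1 (pderiv1 i f) U :=
    fun i f h => pderiv1_contDiffOn hU h (by norm_num) i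
  have key : ∀ i, pderiv1 i (pderiv1 i fun y => f y - g y) x
      = pderiv1 i (pderiv1 i f) x - pderiv1 i (pderiv1 i g) x := by
    intro i
    have h1 : EqOn (pderiv1 i fun y => f y - g y) (fun y => pderiv1 i f y - pderiv1 i g y) U :=
      fun z hz => pderiv1_sub (hd hz hf (by norm_num)) (hd hz hg (by norm_num)) i
    rw [pderiv1_eqOn hU h1 i hx, pderiv1_sub (hd hx (hp i hf) le_rfl) (hd hx (hp i hg) le_rfl)]
  simp only [nlap, lap, key, Finset.sum_sub_distrib]
  ring

theorem nlapIter_sub {U : Set 𝔼} (hU : IsOpen U) (j : ℕ) {f g : 𝔼 → ℝ}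
    (hf : ContDiffOn ℝ (2 * j : ℕ) f U) (hg : ContDiffOn ℝ (2 * j : ℕ) g U) :
    EqOn (nlapIter j fun y => f y - g y) (fun y => nlapIter j f y - nlapIter j g y) U := by
  induction j with
  | zero => intro x _; rfl
  | succ j ih =>
    have hf' : ContDiffOn ℝ (2 : ℕ) (nlapIter j f) U :=
      nlapIter_contDiffOn hU j (by convert hf using 2; ring_nf)
    have hg' : ContDiffOn ℝ (2 : ℕ) (nlapIter j g) U :=
      nlapIter_contDiffOn hU j (by convert hg using 2; ring_nf)
    intro x hx
    simp only [nlapIter_succ]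
    have hle : ((2 * j : ℕ) : WithTop ℕ∞) ≤ (2 * (j + 1) : ℕ) := by
      exact_mod_cast (by omega : 2 * j ≤ 2 * (j + 1))
    rw [nlap_eqOn hU (ih (hf.of_le hle) (hg.of_le hle)) hx]
    exact nlap_sub hU hf' hg' hx

theorem nlap_pderiv1 {U : Set 𝔼} (hU : IsOpen U) {f : 𝔼 → ℝ} (hf : ContDiffOn ℝ (⊤ : ℕ∞) f U)
    (i : Fin n) : EqOn (nlap (pderiv1 i f)) (pderiv1 i (nlap f)) U := by
  intro x hx
  have hp : ∀ i {f : 𝔼 → ℝ}, ContDiffOn ℝ (⊤ : ℕ∞) f U → ContDiffOn ℝ (⊤ : ℕ∞) (pderiv1 i f) U :=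
    fun i f h => pderiv1_contDiffOn hU h (by simp) i
  have hd : ∀ {f : 𝔼 → ℝ}, ContDiffOn ℝ (⊤ : ℕ∞) f U → DifferentiableAt ℝ f x :=
    fun h => (h.contDiffAt (hU.mem_nhds hx)).differentiableAt (by simp)
  have h2 : ∀ {f : 𝔼 → ℝ}, ContDiffOn ℝ (⊤ : ℕ∞) f U → ContDiffOn ℝ 2 f U :=
    fun h => h.of_le ENat.LEInfty.out
  unfold nlap lap
  rw [pderiv1_neg]
  simp only
  rw [pderiv1_sum fun j _ => hd (hp j (hp j hf))]
  congr 1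
  refine Finset.sum_congr rfl fun j _ => ?_
  rw [pderiv1_eqOn hU (pderiv1_comm hU (h2 hf) j i) j hx, pderiv1_comm hU (h2 (hp j hf)) j i hx]

theorem nlapIter_pderiv1 {U : Set 𝔼} (hU : IsOpen U) {f : 𝔼 → ℝ}
    (hf : ContDiffOn ℝ (⊤ : ℕ∞) f U) (i : Fin n) (j : ℕ) :
    EqOn (nlapIter j (pderiv1 i f)) (pderiv1 i (nlapIter j f)) U := by
  induction j with
  | zero => intro x _; rfl
  | succ j ih =>
    rw [nlapIter_succ, nlapIter_succ]
    exact (nlap_eqOn hU ih).trans (nlap_pderiv1 hU (nlapIter_contDiffOn_infty hU j hf) i)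

theorem contDiff_mul_of_tsupport_subset {U : Set 𝔼} (hU : IsOpen U) {k : WithTop ℕ∞} {g f : 𝔼 → ℝ}
    (hg : ContDiff ℝ k g) (hgU : tsupport g ⊆ U) (hf : ContDiffOn ℝ k f U) :
    ContDiff ℝ k fun x => g x * f x := by
  rw [contDiff_iff_contDiffAt]
  intro x
  by_cases hx : x ∈ tsupport g
  · exact hg.contDiffAt.mul (hf.contDiffAt (hU.mem_nhds (hgU hx)))
  · have h0 : g =ᶠ[nhds x] 0 := notMem_tsupport_iff_eventuallyEq.1 hx
    have : (fun x => g x * f x) =ᶠ[nhds x] fun _ => 0 := by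
      filter_upwards [h0] with y hy
      simp [hy]
    exact contDiffAt_const.congr_of_eventuallyEq this

theorem integrable_mul_of_tsupport_subset {U : Set 𝔼} (hU : IsOpen U) {g f : 𝔼 → ℝ}
    (hg : Continuous g) (hgc : HasCompactSupport g) (hgU : tsupport g ⊆ U)
    (hf : ContinuousOn f U) : Integrable fun x => g x * f x := by
  have := contDiff_mul_of_tsupport_subset hU (contDiff_zero.2 hg) hgU (contDiffOn_zero.2 hf)
  exact (contDiff_zero.1 this).integrable_of_hasCompactSupport hgc.mul_right

theorem hasCompactSupport_pderiv1 {f : 𝔼 → ℝ} (hf : HasCompactSupport f) (i : Fin n) :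
    HasCompactSupport (pderiv1 i f) :=
  hf.of_isClosed_subset (isClosed_tsupport _) (tsupport_pderiv1_subset f i)

theorem integral_mul_pderiv1 {U : Set 𝔼} (hU : IsOpen U) {g f : 𝔼 → ℝ}
    (hg : ContDiff ℝ 1 g) (hgc : HasCompactSupport g) (hgU : tsupport g ⊆ U)
    (hf : ContDiffOn ℝ 1 f U) (i : Fin n) :
    ∫ x, g x * pderiv1 i f x = -∫ x, pderiv1 i g x * f x := by
  refine integral_mul_fderiv_eq_neg_fderiv_mul_of_integrable ?_ ?_ ?_ ?_ ?_
  · exact integrable_mul_of_tsupport_subset hU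
      (pderiv1_contDiff hg (k := 0) (by simp) i).continuous (hasCompactSupport_pderiv1 hgc i)
      ((tsupport_pderiv1_subset g i).trans hgU) hf.continuousOn
  · exact integrable_mul_of_tsupport_subset hU hg.continuous hgc hgU
      (pderiv1_contDiffOn hU hf (k := 0) (by simp) i).continuousOn
  · exact integrable_mul_of_tsupport_subset hU hg.continuous hgc hgU hf.continuousOn
  · exact fun x _ => (hg.differentiable (by simp)) x
  · exact fun x hx => (hf.contDiffAt (hU.mem_nhds (hgU hx))).differentiableAt (by simp)

theorem integral_mul_nlap {U : Set 𝔼} (hU : IsOpen U) {g f : 𝔼 → ℝ}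
    (hg : ContDiff ℝ 2 g) (hgc : HasCompactSupport g) (hgU : tsupport g ⊆ U)
    (hf : ContDiffOn ℝ 2 f U) :
    ∫ x, g x * nlap f x = ∫ x, nlap g x * f x := by
  have hg1 : ∀ i, ContDiff ℝ 1 (pderiv1 i g) := fun i => pderiv1_contDiff hg (by norm_num) i
  have hf1 : ∀ i, ContDiffOn ℝ 1 (pderiv1 i f) U :=
    fun i => pderiv1_contDiffOn hU hf (by norm_num) i
  have hs : ∀ i, tsupport (pderiv1 i g) ⊆ U := fun i => (tsupport_pderiv1_subset g i).trans hgU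
  have hc : ∀ i, HasCompactSupport (pderiv1 i g) := fun i => hasCompactSupport_pderiv1 hgc i
  have key : ∀ i, ∫ x, g x * pderiv1 i (pderiv1 i f) x = ∫ x, pderiv1 i (pderiv1 i g) x * f x := by
    intro i
    rw [integral_mul_pderiv1 hU (hg.of_le (by norm_num)) hgc hgU (hf1 i),
      integral_mul_pderiv1 hU (hg1 i) (hc i) (hs i) (hf.of_le (by norm_num)), neg_neg]
  simp only [nlap, lap, mul_neg, neg_mul, integral_neg, Finset.mul_sum, Finset.sum_mul]
  rw [integral_finsetSum, integral_finsetSum]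
  · simp only [key]
  · intro i _
    exact integrable_mul_of_tsupport_subset hU
      (pderiv1_contDiff (hg1 i) (k := 0) (by simp) i).continuous (hasCompactSupport_pderiv1 (hc i) i)
      ((tsupport_pderiv1_subset _ i).trans (hs i)) hf.continuousOn
  · intro i _
    exact integrable_mul_of_tsupport_subset hU hg.continuous hgc hgU
      (pderiv1_contDiffOn hU (hf1 i) (k := 0) (by simp) i).continuousOn

theorem integral_mul_nlapIter {U : Set 𝔼} (hU : IsOpen U) (j : ℕ) {g f : 𝔼 → ℝ}
    (hg : ContDiff ℝ (2 * j : ℕ) g) (hgc : HasCompactSupport g) (hgU : tsupport g ⊆ U)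
    (hf : ContDiffOn ℝ (2 * j : ℕ) f U) :
    ∫ x, g x * nlapIter j f x = ∫ x, nlapIter j g x * f x := by
  induction j generalizing g with
  | zero => rfl
  | succ j ih =>
    have hle : ((2 * j : ℕ) : WithTop ℕ∞) ≤ (2 * (j + 1) : ℕ) := by
      exact_mod_cast (by omega : 2 * j ≤ 2 * (j + 1))
    have hle2 : (2 : WithTop ℕ∞) ≤ (2 * (j + 1) : ℕ) := by
      exact_mod_cast (by omega : 2 ≤ 2 * (j + 1))
    rw [nlapIter_succ, nlapIter_succ', integral_mul_nlap hU (hg.of_le hle2) hgc hgU]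
    · refine ih ?_ (hasCompactSupport_nlapIter 1 hgc) ((tsupport_nlap_subset g).trans hgU)
        (hf.of_le hle)
      exact nlapIter_contDiff 1 (by convert hg using 2; omega)
    · exact nlapIter_contDiffOn hU (k := 2) j (by convert hf using 2; ring_nf)

theorem hasFDerivAt_radial {F : ℝ → ℝ} {F' δ : ℝ} {x : 𝔼}
    (h : HasDerivAt F F' (‖x‖ ^ 2 + δ)) :
    HasFDerivAt (fun y : 𝔼 => F (‖y‖ ^ 2 + δ)) (F' • (2 • innerSL ℝ x)) x := by
  have h1 : HasFDerivAt (fun y : 𝔼 => ‖y‖ ^ 2 + δ) (2 • innerSL ℝ x) x :=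
    (hasStrictFDerivAt_norm_sq x).hasFDerivAt.add_const δ
  exact h.comp_hasFDerivAt x h1

theorem pderiv1_radial {F : ℝ → ℝ} {F' δ : ℝ} {x : 𝔼}
    (h : HasDerivAt F F' (‖x‖ ^ 2 + δ)) (i : Fin n) :
    pderiv1 i (fun y : 𝔼 => F (‖y‖ ^ 2 + δ)) x = 2 * x i * F' := by
  simp only [pderiv1, (hasFDerivAt_radial h).fderiv]
  simp [EuclideanSpace.inner_single_right]
  ring

theorem lap_radial {F F₁ F₂ : ℝ → ℝ} {s : Set ℝ} (hs : IsOpen s) {δ : ℝ}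
    (h1 : ∀ t ∈ s, HasDerivAt F (F₁ t) t) (h2 : ∀ t ∈ s, HasDerivAt F₁ (F₂ t) t) {x : 𝔼}
    (hx : ‖x‖ ^ 2 + δ ∈ s) :
    lap (fun y : 𝔼 => F (‖y‖ ^ 2 + δ)) x
      = 4 * ‖x‖ ^ 2 * F₂ (‖x‖ ^ 2 + δ) + 2 * n * F₁ (‖x‖ ^ 2 + δ) := by
  have hV : IsOpen ((fun y : 𝔼 => ‖y‖ ^ 2 + δ) ⁻¹' s) := hs.preimage (by fun_prop)
  have key : ∀ i : Fin n, pderiv1 i (pderiv1 i fun y : 𝔼 => F (‖y‖ ^ 2 + δ)) x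
      = 4 * (x i) ^ 2 * F₂ (‖x‖ ^ 2 + δ) + 2 * F₁ (‖x‖ ^ 2 + δ) := by
    intro i
    have e1 : EqOn (pderiv1 i fun y : 𝔼 => F (‖y‖ ^ 2 + δ))
        (fun y => 2 * y i * F₁ (‖y‖ ^ 2 + δ)) ((fun y : 𝔼 => ‖y‖ ^ 2 + δ) ⁻¹' s) :=
      fun y hy => pderiv1_radial (h1 _ hy) i
    rw [pderiv1_eqOn hV e1 i hx, pderiv1_mul (by fun_prop)
      (hasFDerivAt_radial (h2 _ hx)).differentiableAt, pderiv1_radial (h2 _ hx),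
      pderiv1_const_mul]
    simp only [pderiv1_coord]
    simp
    ring
  have hsum : ∑ i, x i ^ 2 = ‖x‖ ^ 2 := (EuclideanSpace.real_norm_sq_eq x).symm
  unfold lap
  rw [Finset.sum_congr rfl fun i _ => key i]
  rw [Finset.sum_add_distrib, ← Finset.sum_mul, ← Finset.mul_sum, hsum]
  simp
  ring

theorem contDiff_radial {F : ℝ → ℝ} {k : WithTop ℕ∞} {δ : ℝ} {U : Set 𝔼}
    (h : ∀ x ∈ U, ContDiffAt ℝ k F (‖x‖ ^ 2 + δ)) :
    ContDiffOn ℝ k (fun y : 𝔼 => F (‖y‖ ^ 2 + δ)) U := fun x hx =>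
  ((h x hx).comp x ((contDiff_norm_sq ℝ).add contDiff_const).contDiffAt).contDiffWithinAt

theorem locallyIntegrable_norm_sq_rpow (hn : 0 < n) {b : ℝ} (hb : -(n : ℝ) < 2 * b) :
    LocallyIntegrable fun y : 𝔼 => (‖y‖ ^ 2) ^ b := by
  have : Nonempty (Fin n) := ⟨⟨0, hn⟩⟩
  intro x
  refine ⟨ball 0 (‖x‖ + 1), isOpen_ball.mem_nhds (by simp), ?_⟩
  rw [integrableOn_fun_norm_addHaar volume (f := fun r => (r ^ 2) ^ b)]
  have h1 : IntegrableOn (fun y : ℝ => y ^ ((n : ℝ) - 1 + 2 * b)) (Ioo 0 (‖x‖ + 1)) := by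
    rw [intervalIntegral.integrableOn_Ioo_rpow_iff (by positivity)]
    linarith
  refine h1.congr_fun ?_ measurableSet_Ioo
  intro y hy
  have hy0 : 0 < y := hy.1
  simp only [finrank_euclideanSpace, Fintype.card_fin, smul_eq_mul]
  rw [rpow_add hy0, rpow_mul hy0.le, ← Real.rpow_natCast y (n - 1), Nat.cast_sub hn]
  simp

open Filter Topology in
theorem ae_ne_zero (hn : 0 < n) : ∀ᵐ y : 𝔼, y ≠ 0 := by
  have : Nonempty (Fin n) := ⟨⟨0, hn⟩⟩
  exact compl_mem_ae_iff.2 (measure_singleton (0 : 𝔼))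

/-- Up to a nonzero factor and an additive constant, the fundamental solution of `(-Δ)^j` on `ℝⁿ`
as a function of `‖x‖²`. -/
def fundProfile (n j : ℕ) (t : ℝ) : ℝ :=
  if n = 2 * j then -log t else t ^ ((j : ℝ) - n / 2)

theorem exists_hasDerivAt_fundProfile {n j : ℕ} (hj : 2 * j ≤ n) : ∃ a : ℝ, a ≠ 0 ∧
    ∀ t : ℝ, 0 < t → HasDerivAt (fundProfile n j) (a * t ^ ((j : ℝ) - n / 2 - 1)) t := by
  by_cases h : n = 2 * j
  · refine ⟨-1, by norm_num, fun t ht => ?_⟩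
    have e : fundProfile n j = fun t => -log t := by funext t; simp [fundProfile, h]
    rw [e]
    have hb : (j : ℝ) - n / 2 - 1 = -1 := by rw [h]; push_cast; ring
    rw [hb, rpow_neg_one]
    exact (hasDerivAt_log ht.ne').fun_neg.congr_deriv (by ring)
  · refine ⟨(j : ℝ) - n / 2, ?_, fun t ht => ?_⟩
    · have : (2 * j : ℝ) < n := by exact_mod_cast lt_of_le_of_ne hj (Ne.symm h)
      intro h0; linarith
    · have e : fundProfile n j = fun t => t ^ ((j : ℝ) - n / 2) := by
        funext t; simp [fundProfile, h]
      rw [e]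
      exact hasDerivAt_rpow_const (Or.inl ht.ne')

theorem nlap_fundProfile {j : ℕ} {a : ℝ}
    (ha : ∀ t : ℝ, 0 < t → HasDerivAt (fundProfile n j) (a * t ^ ((j : ℝ) - n / 2 - 1)) t)
    {δ : ℝ} {x : 𝔼} (hx : 0 < ‖x‖ ^ 2 + δ) :
    nlap (fun y : 𝔼 => fundProfile n j (‖y‖ ^ 2 + δ)) x
      = -4 * a * (j - 1) * (‖x‖ ^ 2 + δ) ^ ((j : ℝ) - n / 2 - 1)
        + 4 * a * ((j : ℝ) - n / 2 - 1) * (δ * (‖x‖ ^ 2 + δ) ^ ((j : ℝ) - n / 2 - 2)) := by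
  set b : ℝ := (j : ℝ) - n / 2 with hb
  have h2 : ∀ t ∈ Ioi (0 : ℝ),
      HasDerivAt (fun t : ℝ => a * t ^ (b - 1)) (a * ((b - 1) * t ^ (b - 2))) t := by
    intro t ht
    have := (hasDerivAt_rpow_const (x := t) (p := b - 1) (Or.inl (ne_of_gt ht))).const_mul a
    rwa [show b - 1 - 1 = b - 2 by ring] at this
  simp only [nlap]
  rw [lap_radial isOpen_Ioi ha h2 hx]
  set ρ := ‖x‖ ^ 2 + δ with hρ
  have e : ρ ^ (b - 1) = ρ * ρ ^ (b - 2) := by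
    have := rpow_add hx 1 (b - 2)
    rw [rpow_one] at this
    rw [← this]
    ring_nf
  have hx2 : ‖x‖ ^ 2 = ρ - δ := by rw [hρ]; ring
  have hbn : (n : ℝ) = 2 * j - 2 * b := by rw [hb]; ring
  rw [hx2, hbn, e]
  ring

theorem contDiffAt_fundProfile (j : ℕ) {t : ℝ} (ht : 0 < t) {k : WithTop ℕ∞} :
    ContDiffAt ℝ k (fundProfile n j) t := by
  by_cases h : n = 2 * j
  · have e : fundProfile n j = fun t => -log t := by funext t; simp [fundProfile, h]
    rw [e]
    exact (contDiffAt_log.2 ht.ne').neg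
  · have e : fundProfile n j = fun t => t ^ ((j : ℝ) - n / 2) := by
      funext t; simp [fundProfile, h]
    rw [e]
    exact contDiffAt_rpow_const_of_ne ht.ne'

theorem abs_log_le {t : ℝ} (ht : 0 < t) : |log t| ≤ t + 2 * t ^ (-(1 / 2) : ℝ) := by
  have h1 : 0 < t ^ (-(1 / 2) : ℝ) := rpow_pos_of_pos ht _
  rw [abs_le]
  constructor
  · have := log_le_sub_one_of_pos h1
    rw [log_rpow ht] at this
    linarith
  · have := log_le_sub_one_of_pos ht
    linarith

theorem fundProfile_bound {n j : ℕ} (hj0 : 0 < j) (hj : 2 * j ≤ n) :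
    ∃ B : EuclideanSpace ℝ (Fin n) → ℝ, LocallyIntegrable B ∧
      ∀ δ : ℝ, 0 ≤ δ → δ ≤ 1 → ∀ y : EuclideanSpace ℝ (Fin n), y ≠ 0 →
        |fundProfile n j (‖y‖ ^ 2 + δ)| ≤ B y := by
  have hn : 0 < n := by omega
  have hj' : (2 * j : ℝ) ≤ n := by exact_mod_cast hj
  have hj1 : (1 : ℝ) ≤ j := by exact_mod_cast hj0
  have hmono : ∀ b : ℝ, b ≤ 0 → ∀ δ : ℝ, 0 ≤ δ → ∀ y : EuclideanSpace ℝ (Fin n), y ≠ 0 →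
      (‖y‖ ^ 2 + δ) ^ b ≤ (‖y‖ ^ 2) ^ b := by
    intro b hb δ hδ y hy
    have : 0 < ‖y‖ ^ 2 := by positivity
    exact rpow_le_rpow_of_nonpos this (by linarith) hb
  by_cases h : n = 2 * j
  · refine ⟨fun y => (‖y‖ ^ 2 + 1) + 2 * (‖y‖ ^ 2) ^ (-(1 / 2) : ℝ), ?_, ?_⟩
    · refine (Continuous.locallyIntegrable (by fun_prop)).add
        ((locallyIntegrable_norm_sq_rpow hn (b := -(1 / 2)) ?_).smul (2 : ℝ))
      linarith
    · intro δ h0 h1 y hy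
      have hpos : 0 < ‖y‖ ^ 2 := by positivity
      have := hmono (-(1 / 2)) (by norm_num) δ h0 y hy
      have h2 := abs_log_le (t := ‖y‖ ^ 2 + δ) (by linarith)
      rw [fundProfile, if_pos h, abs_neg]
      linarith
  · refine ⟨fun y => (‖y‖ ^ 2) ^ ((j : ℝ) - n / 2),
      locallyIntegrable_norm_sq_rpow hn (by linarith), ?_⟩
    intro δ h0 h1 y hy
    rw [fundProfile, if_neg h, abs_of_nonneg (by positivity)]
    exact hmono _ (by linarith) δ h0 y hy

theorem integrable_mul_of_locallyIntegrable {B f : 𝔼 → ℝ} (hB : LocallyIntegrable B)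
    (hf : Continuous f) (hfc : HasCompactSupport f) : Integrable fun y => B y * f y := by
  have := hB.integrable_smul_left_of_hasCompactSupport hf hfc
  simpa [mul_comm] using this

theorem measurable_fundProfile (n j : ℕ) : Measurable (fundProfile n j) := by
  by_cases h : n = 2 * j
  · have e : fundProfile n j = fun t => -log t := by funext t; simp [fundProfile, h]
    rw [e]; fun_prop
  · have e : fundProfile n j = fun t => t ^ ((j : ℝ) - n / 2) := by
      funext t; simp [fundProfile, h]
    rw [e]; fun_prop

theorem locallyIntegrable_fundProfile {n j : ℕ} (hj0 : 0 < j) (hj : 2 * j ≤ n) :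
    LocallyIntegrable fun y : EuclideanSpace ℝ (Fin n) => fundProfile n j (‖y‖ ^ 2) := by
  obtain ⟨B, hB, hle⟩ := fundProfile_bound hj0 hj
  refine hB.mono ((measurable_fundProfile n j).comp (by fun_prop)).aestronglyMeasurable ?_
  filter_upwards [ae_ne_zero (n := n) (by omega)] with y hy
  have := hle 0 le_rfl zero_le_one y hy
  rw [add_zero] at this
  exact this.trans (le_abs_self _)

open Filter Topology in
theorem tendsto_integral_fundProfile {n j : ℕ} (hj0 : 0 < j) (hj : 2 * j ≤ n)
    {g : EuclideanSpace ℝ (Fin n) → ℝ} (hg : Continuous g) (hgc : HasCompactSupport g) :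
    Tendsto (fun δ : ℝ => ∫ y, fundProfile n j (‖y‖ ^ 2 + δ) * g y) (𝓝[>] 0)
      (𝓝 (∫ y, fundProfile n j (‖y‖ ^ 2) * g y)) := by
  obtain ⟨B, hB, hle⟩ := fundProfile_bound hj0 hj
  refine tendsto_integral_filter_of_dominated_convergence (fun y => B y * |g y|) ?_ ?_ ?_ ?_
  · refine Eventually.of_forall fun δ => ?_
    exact (((measurable_fundProfile n j).comp (by fun_prop)).mul hg.measurable).aestronglyMeasurable
  · filter_upwards [Ioc_mem_nhdsGT one_pos] with δ hδ
    filter_upwards [ae_ne_zero (n := n) (by omega)] with y hy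
    rw [norm_mul]
    exact mul_le_mul_of_nonneg_right (hle δ hδ.1.le hδ.2 y hy) (abs_nonneg _)
  · exact integrable_mul_of_locallyIntegrable hB hg.abs hgc.norm
  · filter_upwards [ae_ne_zero (n := n) (by omega)] with y hy
    refine Tendsto.mul_const _ ?_
    have hpos : 0 < ‖y‖ ^ 2 := by positivity
    have h1 : ContinuousAt (fundProfile n j) (‖y‖ ^ 2) :=
      (contDiffAt_fundProfile (k := 0) j hpos).continuousAt
    have h2 : Tendsto (fun δ : ℝ => ‖y‖ ^ 2 + δ) (𝓝[>] 0) (𝓝 (‖y‖ ^ 2)) := by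
      have : Continuous fun δ : ℝ => ‖y‖ ^ 2 + δ := by fun_prop
      simpa using this.continuousWithinAt.tendsto (x := (0 : ℝ)) (s := Ioi 0)
    exact h1.tendsto.comp h2

theorem integral_fundProfile_nlap (j : ℕ) {v : 𝔼 → ℝ} (hv : ContDiff ℝ 2 v)
    (hvc : HasCompactSupport v) {δ : ℝ} (hδ : 0 < δ) :
    ∫ y, fundProfile n j (‖y‖ ^ 2 + δ) * nlap v y
      = ∫ y, nlap (fun y : 𝔼 => fundProfile n j (‖y‖ ^ 2 + δ)) y * v y := by
  have := integral_mul_nlap (U := univ) isOpen_univ hv hvc (subset_univ _)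
    (contDiff_radial (F := fundProfile n j) (δ := δ) (fun x _ =>
      contDiffAt_fundProfile j (by positivity)))
  simp only [mul_comm (v _)] at this
  rw [this]
  simp only [mul_comm]

open Filter Topology in
theorem weak_fundProfile_step {n j : ℕ} (hj1 : 1 < j) (hj : 2 * j ≤ n) : ∃ a : ℝ, a ≠ 0 ∧
    ∀ v : EuclideanSpace ℝ (Fin n) → ℝ, ContDiff ℝ 2 v → HasCompactSupport v →
      ∫ y, fundProfile n j (‖y‖ ^ 2) * nlap v y
        = a * ∫ y, fundProfile n (j - 1) (‖y‖ ^ 2) * v y := by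
  obtain ⟨a, ha0, ha⟩ := exists_hasDerivAt_fundProfile hj
  have hj' : (2 * j : ℝ) ≤ n := by exact_mod_cast hj
  have hj1' : (1 : ℝ) < j := by exact_mod_cast hj1
  refine ⟨-4 * a * (j - 1), by simp [ha0]; linarith, fun v hv hvc => ?_⟩
  set b : ℝ := (j : ℝ) - n / 2 with hb
  have hcv : Continuous (nlap v) :=
    (nlapIter_contDiff (k := 0) 1 (f := v) (by simpa using hv)).continuous
  have h1 := tendsto_integral_fundProfile (by omega) hj hcv (hasCompactSupport_nlapIter 1 hvc)
  have hprof : ∀ t, fundProfile n (j - 1) t = t ^ (b - 1) := by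
    intro t
    rw [fundProfile, if_neg (by omega), Nat.cast_sub hj1.le, hb]
    congr 1; push_cast; ring
  have h2 : Tendsto (fun δ : ℝ => ∫ y, fundProfile n j (‖y‖ ^ 2 + δ) * nlap v y) (𝓝[>] 0)
      (𝓝 (∫ y : EuclideanSpace ℝ (Fin n), (-4 * a * (j - 1) * (‖y‖ ^ 2) ^ (b - 1)) * v y)) := by
    have hev : (fun δ : ℝ => ∫ y : EuclideanSpace ℝ (Fin n),
        (-4 * a * (j - 1) * (‖y‖ ^ 2 + δ) ^ (b - 1)
        + 4 * a * (b - 1) * (δ * (‖y‖ ^ 2 + δ) ^ (b - 2))) * v y) =ᶠ[𝓝[>] 0]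
        (fun δ : ℝ => ∫ y, fundProfile n j (‖y‖ ^ 2 + δ) * nlap v y) := by
      filter_upwards [self_mem_nhdsWithin] with δ (hδ : 0 < δ)
      rw [integral_fundProfile_nlap j hv hvc hδ]
      refine integral_congr_ae (Eventually.of_forall fun y => ?_)
      simp only
      rw [nlap_fundProfile ha (by positivity)]
    refine Tendsto.congr' hev ?_
    refine tendsto_integral_filter_of_dominated_convergence
      (fun y => (‖y‖ ^ 2) ^ (b - 1) * ((|(-4 * a * (j - 1))| + |4 * a * (b - 1)|) * |v y|))
      ?_ ?_ ?_ ?_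
    · refine Eventually.of_forall fun δ => ?_
      have := hv.continuous.measurable
      exact Measurable.aestronglyMeasurable (by fun_prop)
    · filter_upwards [self_mem_nhdsWithin] with δ (hδ : 0 < δ)
      filter_upwards [ae_ne_zero (n := n) (by omega)] with y hy
      have hpos : 0 < ‖y‖ ^ 2 := by positivity
      have hm : (‖y‖ ^ 2 + δ) ^ (b - 1) ≤ (‖y‖ ^ 2) ^ (b - 1) :=
        rpow_le_rpow_of_nonpos hpos (by linarith) (by linarith)
      have hm2 : δ * (‖y‖ ^ 2 + δ) ^ (b - 2) ≤ (‖y‖ ^ 2) ^ (b - 1) := by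
        refine le_trans ?_ hm
        have : (‖y‖ ^ 2 + δ) ^ (b - 1) = (‖y‖ ^ 2 + δ) * (‖y‖ ^ 2 + δ) ^ (b - 2) := by
          rw [← rpow_one_add' (by positivity) (by linarith)]; ring_nf
        rw [this]
        exact mul_le_mul_of_nonneg_right (by linarith) (by positivity)
      rw [norm_mul, ← mul_assoc ((‖y‖ ^ 2) ^ (b - 1))]
      refine mul_le_mul_of_nonneg_right ?_ (norm_nonneg (v y))
      refine (norm_add_le _ _).trans ?_
      rw [norm_mul _ ((‖y‖ ^ 2 + δ) ^ (b - 1)), norm_mul _ (δ * _),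
        norm_of_nonneg (by positivity : 0 ≤ (‖y‖ ^ 2 + δ) ^ (b - 1)),
        norm_of_nonneg (by positivity : 0 ≤ δ * (‖y‖ ^ 2 + δ) ^ (b - 2)), mul_comm, mul_add]
      simp only [Real.norm_eq_abs]
      refine _root_.add_le_add ?_ ?_
      · exact mul_le_mul_of_nonneg_right hm (abs_nonneg _)
      · rw [mul_comm]
        exact mul_le_mul_of_nonneg_right hm2 (abs_nonneg _)
    · refine integrable_mul_of_locallyIntegrable
        (locallyIntegrable_norm_sq_rpow (n := n) (by omega) ?_) (continuous_const.mul hv.continuous.abs) (hvc.norm.mul_left)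
      linarith
    · filter_upwards [ae_ne_zero (n := n) (by omega)] with y hy
      refine Tendsto.mul_const _ ?_
      have hpos : 0 < ‖y‖ ^ 2 := by positivity
      have hc : ContinuousAt (fun δ : ℝ => -4 * a * (j - 1) * (‖y‖ ^ 2 + δ) ^ (b - 1)
        + 4 * a * (b - 1) * (δ * (‖y‖ ^ 2 + δ) ^ (b - 2))) 0 := by
        have h3 : ContinuousAt (fun δ : ℝ => ‖y‖ ^ 2 + δ) 0 := by fun_prop
        have h4 : ∀ c : ℝ, ContinuousAt (fun δ : ℝ => (‖y‖ ^ 2 + δ) ^ c) 0 := fun c =>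
          h3.rpow_const (Or.inl (by simpa using hy))
        exact (continuousAt_const.mul (h4 _)).add
          (continuousAt_const.mul (continuousAt_id.mul (h4 _)))
      simpa using hc.tendsto.mono_left nhdsWithin_le_nhds
  rw [tendsto_nhds_unique h1 h2, ← integral_const_mul]
  simp only [hprof, mul_assoc]

open Filter Topology in
theorem weak_fundProfile_one {n : ℕ} (hn : 2 ≤ n) : ∃ a : ℝ, a ≠ 0 ∧
    ∀ v : EuclideanSpace ℝ (Fin n) → ℝ, ContDiff ℝ 2 v → HasCompactSupport v →
      ∫ y, fundProfile n 1 (‖y‖ ^ 2) * nlap v y = a * v 0 := by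
  obtain ⟨a, ha0, ha⟩ := exists_hasDerivAt_fundProfile (n := n) (j := 1) (by omega)
  have hn' : (2 : ℝ) ≤ n := by exact_mod_cast hn
  set p : ℝ := ((1 : ℕ) : ℝ) - n / 2 - 2 with hp
  have hpe : p = -(n + 2) / 2 := by rw [hp]; push_cast; ring
  have hI : Integrable fun z : EuclideanSpace ℝ (Fin n) => (1 + ‖z‖ ^ 2) ^ p := by
    rw [hpe]
    exact integrable_rpow_neg_one_add_norm_sq (by simp)
  have hIpos : 0 < ∫ z : EuclideanSpace ℝ (Fin n), (1 + ‖z‖ ^ 2) ^ p := by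
    rw [integral_pos_iff_support_of_nonneg (fun z => by positivity) hI]
    have : Function.support (fun z : EuclideanSpace ℝ (Fin n) => (1 + ‖z‖ ^ 2) ^ p) = univ := by
      ext z
      simp only [Function.mem_support, mem_univ, iff_true]
      positivity
    rw [this]
    exact isOpen_univ.measure_pos volume univ_nonempty
  set I := ∫ z : EuclideanSpace ℝ (Fin n), (1 + ‖z‖ ^ 2) ^ p
  refine ⟨4 * a * (((1 : ℕ) : ℝ) - n / 2 - 1) * I, ?_, fun v hv hvc => ?_⟩
  · have : ((1 : ℕ) : ℝ) - n / 2 - 1 ≠ 0 := by push_cast; intro h; linarith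
    exact mul_ne_zero (mul_ne_zero (mul_ne_zero (by norm_num) ha0) this) hIpos.ne'
  have hcv : Continuous (nlap v) :=
    (nlapIter_contDiff (k := 0) 1 (f := v) (by simpa using hv)).continuous
  have h1 := tendsto_integral_fundProfile one_pos hn hcv (hasCompactSupport_nlapIter 1 hvc)
  have hsq : Tendsto (fun ε : ℝ => ε ^ 2) (𝓝[>] 0) (𝓝[>] 0) := by
    refine tendsto_nhdsWithin_iff.2 ⟨?_, ?_⟩
    · have : Continuous fun ε : ℝ => ε ^ 2 := by fun_prop
      simpa using this.continuousWithinAt.tendsto (x := (0 : ℝ)) (s := Ioi 0)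
    · filter_upwards [self_mem_nhdsWithin] with ε (hε : 0 < ε)
      exact pow_pos hε 2
  have h1' := h1.comp hsq
  obtain ⟨M, hM⟩ := hv.continuous.bounded_above_of_compact_support hvc
  have h2 : Tendsto (fun ε : ℝ => ∫ z : EuclideanSpace ℝ (Fin n), (1 + ‖z‖ ^ 2) ^ p * v (ε • z))
      (𝓝[>] 0) (𝓝 (∫ z : EuclideanSpace ℝ (Fin n), (1 + ‖z‖ ^ 2) ^ p * v 0)) := by
    refine tendsto_integral_filter_of_dominated_convergence
      (fun z => (1 + ‖z‖ ^ 2) ^ p * M) ?_ ?_ (hI.mul_const M) ?_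
    · refine Eventually.of_forall fun ε => ?_
      have := hv.continuous.measurable
      exact Measurable.aestronglyMeasurable (by fun_prop)
    · refine Eventually.of_forall fun ε => Eventually.of_forall fun z => ?_
      rw [norm_mul, norm_of_nonneg (by positivity : 0 ≤ (1 + ‖z‖ ^ 2) ^ p)]
      exact mul_le_mul_of_nonneg_left (hM _) (by positivity)
    · refine Eventually.of_forall fun z => Tendsto.const_mul _ ?_
      have : Continuous fun ε : ℝ => v (ε • z) := hv.continuous.comp (by fun_prop)
      simpa using this.continuousWithinAt.tendsto (x := (0 : ℝ)) (s := Ioi 0)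
  have hev : (fun ε : ℝ => 4 * a * (((1 : ℕ) : ℝ) - n / 2 - 1) *
      ∫ z : EuclideanSpace ℝ (Fin n), (1 + ‖z‖ ^ 2) ^ p * v (ε • z)) =ᶠ[𝓝[>] 0]
      ((fun δ : ℝ => ∫ y, fundProfile n 1 (‖y‖ ^ 2 + δ) * nlap v y) ∘ fun ε : ℝ => ε ^ 2) := by
    filter_upwards [self_mem_nhdsWithin] with ε (hε : 0 < ε)
    simp only [Function.comp]
    rw [integral_fundProfile_nlap 1 hv hvc (by positivity : 0 < ε ^ 2), ← integral_const_mul]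
    have hnl : ∀ y : EuclideanSpace ℝ (Fin n),
        nlap (fun y => fundProfile n 1 (‖y‖ ^ 2 + ε ^ 2)) y * v y
        = 4 * a * (((1 : ℕ) : ℝ) - n / 2 - 1) * (ε ^ 2 * (‖y‖ ^ 2 + ε ^ 2) ^ p * v y) := by
      intro y
      rw [nlap_fundProfile ha (by positivity)]
      push_cast
      simp only [hp]
      push_cast
      ring
    simp only [hnl]
    have hcs := Measure.integral_comp_smul (volume : Measure (EuclideanSpace ℝ (Fin n)))
      (fun y => 4 * a * (((1 : ℕ) : ℝ) - n / 2 - 1) * (ε ^ 2 * (‖y‖ ^ 2 + ε ^ 2) ^ p * v y)) ε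
    simp only [finrank_euclideanSpace, Fintype.card_fin, smul_eq_mul] at hcs
    rw [abs_of_pos (by positivity)] at hcs
    have hεn : (0 : ℝ) < ε ^ n := by positivity
    have : ∀ X Y : ℝ, X = (ε ^ n)⁻¹ * Y → Y = ε ^ n * X := by
      intro X Y h; rw [h]; field_simp
    rw [this _ _ hcs, ← integral_const_mul]
    refine integral_congr_ae (Eventually.of_forall fun z => ?_)
    simp only
    have e1 : ‖ε • z‖ ^ 2 + ε ^ 2 = ε ^ 2 * (1 + ‖z‖ ^ 2) := by
      rw [norm_smul, Real.norm_eq_abs, abs_of_pos hε]; ring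
    have e2 : (ε ^ 2) ^ p = (ε ^ n)⁻¹ * (ε ^ 2)⁻¹ := by
      rw [← Real.rpow_natCast ε 2, ← rpow_mul hε.le, ← Real.rpow_natCast ε n, ← rpow_neg hε.le,
        ← rpow_neg hε.le, ← rpow_add hε]
      congr 1; rw [hpe]; push_cast; ring
    rw [e1, mul_rpow (by positivity) (by positivity), e2]
    field_simp
  have h3 := (h2.const_mul (4 * a * (((1 : ℕ) : ℝ) - n / 2 - 1))).congr' hev
  rw [tendsto_nhds_unique h1' h3, integral_mul_const]
  ring

theorem weak_fundProfile {n j : ℕ} (hj0 : 0 < j) (hj : 2 * j ≤ n) : ∃ a : ℝ, a ≠ 0 ∧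
    ∀ w : EuclideanSpace ℝ (Fin n) → ℝ, ContDiff ℝ (2 * j : ℕ) w → HasCompactSupport w →
      ∫ y, fundProfile n j (‖y‖ ^ 2) * nlapIter j w y = a * w 0 := by
  induction j, hj0 using Nat.le_induction with
  | base => 
    obtain ⟨a, ha, h⟩ := weak_fundProfile_one (n := n) (by omega)
    exact ⟨a, ha, fun w hw hwc => h w (by simpa using hw) hwc⟩
  | succ j hj0 ih =>
    obtain ⟨a, ha, h⟩ := ih (by omega)
    obtain ⟨a', ha', h'⟩ := weak_fundProfile_step (n := n) (j := j + 1) (by omega) hj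
    refine ⟨a' * a, mul_ne_zero ha' ha, fun w hw hwc => ?_⟩
    rw [nlapIter_succ, h' _ (nlapIter_contDiff (k := 2) j (by convert hw using 2; ring_nf))
      (hasCompactSupport_nlapIter j hwc), Nat.add_sub_cancel, h w (hw.of_le ?_) hwc, mul_assoc]
    exact_mod_cast (by omega : 2 * j ≤ 2 * (j + 1))

theorem nlapIter_fundProfile {n j : ℕ} (hj0 : 0 < j) (hj : 2 * j ≤ n) :
    EqOn (nlapIter j fun y : EuclideanSpace ℝ (Fin n) => fundProfile n j (‖y‖ ^ 2)) 0 {0}ᶜ := by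
  have key : ∀ j, 2 * j ≤ n → ∃ a : ℝ, ∀ y : EuclideanSpace ℝ (Fin n), y ≠ 0 →
      nlap (fun y : EuclideanSpace ℝ (Fin n) => fundProfile n j (‖y‖ ^ 2)) y
        = -4 * a * (j - 1) * (‖y‖ ^ 2) ^ ((j : ℝ) - n / 2 - 1) := by
    intro j hj
    obtain ⟨a, -, ha⟩ := exists_hasDerivAt_fundProfile hj
    refine ⟨a, fun y hy => ?_⟩
    have := nlap_fundProfile ha (δ := 0) (x := y) (by positivity)
    simpa using this
  induction j, hj0 using Nat.le_induction with
  | base =>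
    intro y hy
    obtain ⟨a, ha⟩ := key 1 hj
    simpa [nlapIter] using ha y hy
  | succ j hj0 ih =>
    intro y hy
    obtain ⟨a, ha⟩ := key (j + 1) hj
    have e : EqOn (nlap fun y : EuclideanSpace ℝ (Fin n) => fundProfile n (j + 1) (‖y‖ ^ 2))
        (fun y => (-4 * a * j) * fundProfile n j (‖y‖ ^ 2)) {0}ᶜ := by
      intro z hz
      rw [ha z hz]
      simp only
      rw [fundProfile, if_neg (by omega)]
      push_cast
      ring_nf
    rw [nlapIter_succ', nlapIter_eqOn isOpen_compl_singleton e j hy, nlapIter_const_mul]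
    simp [ih (by omega) hy]

theorem exists_fundSol_eq {m n : ℕ} {c : ℝ} (hc : c ≠ 0) : ∃ α κ : ℝ, α ≠ 0 ∧
    EqOn (fundSol m n c) (fun x => α * fundProfile n m (‖x‖ ^ 2) - κ) {0}ᶜ := by
  by_cases h : n = 2 * m
  · refine ⟨c / 2, -(c * log 5), by simpa using hc, fun x hx => ?_⟩
    have hx' : ‖x‖ ≠ 0 := norm_ne_zero_iff.2 hx
    simp only [fundSol, fundProfile, if_pos h]
    rw [log_div (by norm_num) hx', log_pow]
    push_cast
    ring
  · refine ⟨c, 0, hc, fun x hx => ?_⟩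
    have hx' : 0 < ‖x‖ := norm_pos_iff.2 hx
    simp only [fundSol, fundProfile, if_neg h]
    rw [← Real.rpow_natCast ‖x‖ 2, ← rpow_mul hx'.le, ← rpow_intCast]
    rw [sub_zero]
    congr 2
    push_cast
    ring

theorem contDiffOn_fundProfile_norm (m n : ℕ) {k : WithTop ℕ∞} :
    ContDiffOn ℝ k (fun y : EuclideanSpace ℝ (Fin n) => fundProfile n m (‖y‖ ^ 2)) {0}ᶜ := by
  have := contDiff_radial (F := fundProfile n m) (δ := 0) (k := k)
    (U := ({0}ᶜ : Set (EuclideanSpace ℝ (Fin n)))) fun x (hx : x ≠ 0) =>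
      contDiffAt_fundProfile m (by positivity)
  simpa using this

theorem contDiffOn_fundSol {m n : ℕ} {c : ℝ} (hc : c ≠ 0) {k : WithTop ℕ∞} :
    ContDiffOn ℝ k (fundSol m n c) {0}ᶜ := by
  obtain ⟨α, κ, -, h⟩ := exists_fundSol_eq (m := m) (n := n) hc
  exact ((contDiffOn_const.mul (contDiffOn_fundProfile_norm m n)).sub contDiffOn_const).congr h

theorem nlapIter_const {m : ℕ} (hm : 0 < m) (κ : ℝ) :
    nlapIter m (fun _ : 𝔼 => κ) = fun _ => 0 := by
  obtain ⟨k, rfl⟩ := Nat.exists_eq_succ_of_ne_zero hm.ne'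
  have h0 : ∀ κ : ℝ, nlap (fun _ : 𝔼 => κ) = fun _ => 0 := by
    intro κ
    funext x
    have : ∀ (i : Fin n) (κ : ℝ), pderiv1 i (fun _ : 𝔼 => κ) = fun _ => 0 := by
      intro i κ; funext x; simp [pderiv1]
    simp [nlap, lap, this]
  have h1 : ∀ k, nlapIter k (fun _ : 𝔼 => (0 : ℝ)) = fun _ => 0 := by
    intro k
    induction k with
    | zero => rfl
    | succ k ih => rw [nlapIter_succ, ih, h0]
  rw [Nat.succ_eq_add_one, nlapIter_succ', h0, h1]

theorem nlapIter_fundSol {m n : ℕ} (hm : 0 < m) (hn : 2 * m ≤ n) {c : ℝ} (hc : c ≠ 0) :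
    EqOn (nlapIter m (fundSol m n c)) 0 {0}ᶜ := by
  obtain ⟨α, κ, -, h⟩ := exists_fundSol_eq (m := m) (n := n) hc
  intro x hx
  rw [nlapIter_eqOn isOpen_compl_singleton h m hx, nlapIter_sub isOpen_compl_singleton m
    (contDiffOn_const.mul (contDiffOn_fundProfile_norm m n)) contDiffOn_const hx,
    nlapIter_const_mul, nlapIter_const hm]
  simp [nlapIter_fundProfile hm hn hx]

theorem fundSol_ae_eq {m n : ℕ} (hn : 0 < n) {c α κ : ℝ}
    (h : EqOn (fundSol m n c) (fun x => α * fundProfile n m (‖x‖ ^ 2) - κ) {0}ᶜ) :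
    fundSol m n c =ᵐ[volume] (fun x => α * fundProfile n m (‖x‖ ^ 2) - κ) := by
  filter_upwards [ae_ne_zero hn] with x hx using h hx

theorem locallyIntegrable_fundSol {m n : ℕ} (hm : 0 < m) (hn : 2 * m ≤ n) {c : ℝ} (hc : c ≠ 0) :
    LocallyIntegrable (fundSol m n c) := by
  obtain ⟨α, κ, -, h⟩ := exists_fundSol_eq (m := m) (n := n) hc
  have h1 : LocallyIntegrable fun x : EuclideanSpace ℝ (Fin n) =>
      α * fundProfile n m (‖x‖ ^ 2) - κ :=
    ((locallyIntegrable_fundProfile hm hn).smul α).sub (locallyIntegrable_const κ)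
  have hae := fundSol_ae_eq (by omega) h
  intro x
  obtain ⟨s, hs, hi⟩ := h1 x
  exact ⟨s, hs, hi.congr (ae_restrict_of_ae hae.symm)⟩

theorem exists_fundSol_representation {m n : ℕ} (hm : 0 < m) (hn : 2 * m ≤ n) {c : ℝ}
    (hc : c ≠ 0) : ∃ K : ℝ, ∀ w : EuclideanSpace ℝ (Fin n) → ℝ, ContDiff ℝ (2 * m : ℕ) w →
      HasCompactSupport w → ∀ x, w x = K * ∫ y, fundSol m n c (x - y) * nlapIter m w y := by
  obtain ⟨α, κ, hα, h⟩ := exists_fundSol_eq (m := m) (n := n) hc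
  obtain ⟨a, ha, hw0⟩ := weak_fundProfile hm hn
  refine ⟨(α * a)⁻¹, fun w hw hwc x => ?_⟩
  set v : EuclideanSpace ℝ (Fin n) → ℝ := fun y => w (x - y) with hv
  have hvd : ContDiff ℝ (2 * m : ℕ) v := hw.comp (contDiff_const.sub contDiff_id)
  have hvc : HasCompactSupport v := by
    exact hwc.comp_homeomorph (Homeomorph.subLeft x)
  have hnv : Continuous (nlapIter m v) :=
    (nlapIter_contDiff (k := 0) m (by simpa using hvd)).continuous
  have hnvc := hasCompactSupport_nlapIter m hvc
  have e1 : ∫ y, fundSol m n c (x - y) * nlapIter m w y = ∫ y, fundSol m n c y * nlapIter m v y := by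
    rw [← integral_sub_left_eq_self (fun y => fundSol m n c (x - y) * nlapIter m w y) volume x,
      hv, nlapIter_const_sub_comp]
    simp
  have e2 : ∫ y, fundSol m n c y * nlapIter m v y
      = ∫ y, (α * (fundProfile n m (‖y‖ ^ 2) * nlapIter m v y) - κ * nlapIter m v y) := by
    refine integral_congr_ae ?_
    filter_upwards [fundSol_ae_eq (by omega) h] with y hy
    rw [hy]; ring
  have e3 : ∫ y, κ * nlapIter m v y = 0 := by
    have := integral_mul_nlapIter (U := univ) isOpen_univ m hvd hvc (subset_univ _)
      (f := fun _ => κ) contDiffOn_const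
    simp only [nlapIter_const hm, mul_zero, integral_zero] at this
    simp only [mul_comm κ, ← this]
  rw [e1, e2, integral_sub, integral_const_mul, e3, hw0 v hvd hvc, sub_zero]
  · simp only [hv, sub_zero]
    field_simp
  · exact (integrable_mul_of_locallyIntegrable (locallyIntegrable_fundProfile hm hn)
      hnv hnvc).const_mul α
  · exact (hnv.integrable_of_hasCompactSupport hnvc).const_mul κ

theorem contDiffOn_potential {φ f : 𝔼 → ℝ} (hφ : ContDiffOn ℝ (⊤ : ℕ∞) φ {0}ᶜ)
    (hf : Continuous f) (hfc : HasCompactSupport f) {x₀ : 𝔼} {r : ℝ} (hr : 0 < r)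
    (hf0 : ∀ y ∈ ball x₀ (2 * r), f y = 0) :
    ContDiffOn ℝ (⊤ : ℕ∞) (fun x => ∫ y, φ (x - y) * f y) (ball x₀ r) := by
  obtain ⟨M, hM⟩ := hfc.isBounded.subset_closedBall x₀
  let β : ContDiffBump (0 : 𝔼) := ⟨r / 2, r, by positivity, by linarith⟩
  let β₂ : ContDiffBump (0 : 𝔼) := ⟨r + |M| + 1, r + |M| + 2, by positivity, by linarith⟩
  let g : 𝔼 → ℝ := fun z => (1 - β z) * β₂ z
  have hg : ContDiff ℝ (⊤ : ℕ∞) g := (contDiff_const.sub β.contDiff).mul β₂.contDiff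
  have hgc : HasCompactSupport g := β₂.hasCompactSupport.mul_left
  have hgs : tsupport g ⊆ {0}ᶜ := by
    intro z hz hz0
    rw [mem_singleton_iff] at hz0
    subst hz0
    refine notMem_tsupport_iff_eventuallyEq.2 ?_ hz
    filter_upwards [β.eventuallyEq_one] with z hz
    simp [g, hz]
  have hk := contDiff_mul_of_tsupport_subset isOpen_compl_singleton hg hgs hφ
  have hkc : HasCompactSupport fun z => g z * φ z := hgc.mul_right
  have hconv := hkc.contDiff_convolution_right (ContinuousLinearMap.mul ℝ ℝ)
    (hf.locallyIntegrable (μ := volume)) hk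
  refine hconv.contDiffOn.congr fun x hx => ?_
  rw [convolution_def]
  congr 1
  funext y
  simp only [ContinuousLinearMap.mul_apply']
  by_cases hy : f y = 0
  · simp [hy]
  · have h1 : 2 * r ≤ dist y x₀ := by
      by_contra hlt
      exact hy (hf0 y (by simpa using hlt))
    have h2 : dist y x₀ ≤ M := hM (subset_tsupport _ hy)
    have h3 : dist x x₀ < r := hx
    have h4 : r ≤ ‖x - y‖ := by
      rw [← dist_eq_norm]
      have := dist_triangle_left y x₀ x
      linarith
    have h5 : ‖x - y‖ ≤ r + |M| + 1 := by
      rw [← dist_eq_norm]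
      have := dist_triangle_right x y x₀
      have := le_abs_self M
      linarith
    have e1 : β (x - y) = 0 := β.zero_of_le_dist (by simpa using h4)
    have e2 : β₂ (x - y) = 1 := β₂.one_of_mem_closedBall (by simpa using h5)
    simp only [g, e1, e2]
    ring

/-- Smooth functions on the line that vanish outside `Icc a b`. -/
def SmoothOff (a b : ℝ) (g : ℝ → ℝ) : Prop :=
  ContDiff ℝ (⊤ : ℕ∞) g ∧ ∀ s, s ∉ Icc a b → g s = 0

theorem SmoothOff.deriv {a b : ℝ} {g : ℝ → ℝ} (h : SmoothOff a b g) : SmoothOff a b (deriv g) := by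
  refine ⟨h.1.iterate_deriv 1, fun s hs => ?_⟩
  have : g =ᶠ[nhds s] fun _ => 0 := by
    filter_upwards [isClosed_Icc.isOpen_compl.mem_nhds hs] with t ht using h.2 t ht
  rw [this.deriv_eq, deriv_const]

theorem SmoothOff.const_mul {a b : ℝ} {g : ℝ → ℝ} (h : SmoothOff a b g) (r : ℝ) :
    SmoothOff a b fun s => r * g s :=
  ⟨contDiff_const.mul h.1, fun s hs => by simp only [h.2 s hs, mul_zero]⟩

theorem SmoothOff.id_mul {a b : ℝ} {g : ℝ → ℝ} (h : SmoothOff a b g) :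
    SmoothOff a b fun s => s * g s :=
  ⟨contDiff_id.mul h.1, fun s hs => by simp only [h.2 s hs, mul_zero]⟩

theorem SmoothOff.add {a b : ℝ} {g f : ℝ → ℝ} (h : SmoothOff a b g) (hf : SmoothOff a b f) :
    SmoothOff a b fun s => g s + f s :=
  ⟨h.1.add hf.1, fun s hs => by simp only [h.2 s hs, hf.2 s hs, add_zero]⟩

theorem SmoothOff.exists_bound {a b : ℝ} {g : ℝ → ℝ} (h : SmoothOff a b g) :
    ∃ C, 0 ≤ C ∧ ∀ s, |g s| ≤ C := by
  obtain ⟨C, hC⟩ := HasCompactSupport.exists_bound_of_continuous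
    (HasCompactSupport.intro isCompact_Icc h.2) h.1.continuous
  exact ⟨C, (abs_nonneg _).trans (hC 0), hC⟩

theorem tsupport_radial_subset {a b : ℝ} {g : ℝ → ℝ} (h : SmoothOff a b g) (t : ℝ) :
    tsupport (fun y : 𝔼 => g (t * ‖y‖ ^ 2)) ⊆ {y | t * ‖y‖ ^ 2 ∈ Icc a b} := by
  refine closure_minimal (fun y hy => ?_) (isClosed_Icc.preimage (by fun_prop))
  by_contra hc
  exact hy (h.2 _ hc)

theorem annulus_subset {a b t : ℝ} (ha : 0 < a) (hb : b < 1) (ht : 1 ≤ t) :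
    {y : 𝔼 | t * ‖y‖ ^ 2 ∈ Icc a b} ⊆ ball 0 1 \ {0} := by
  rintro y ⟨h1, h2⟩
  refine ⟨?_, ?_⟩
  · rw [mem_ball_zero_iff]
    nlinarith [norm_nonneg y, sq_nonneg ‖y‖, mul_nonneg (sub_nonneg.2 ht) (sq_nonneg ‖y‖)]
  · rintro rfl
    simp at h1
    linarith

theorem isCompact_annulus {a b t : ℝ} (ht : 0 < t) :
    IsCompact {y : 𝔼 | t * ‖y‖ ^ 2 ∈ Icc a b} := by
  refine isCompact_of_isClosed_isBounded (isClosed_Icc.preimage (by fun_prop)) ?_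
  refine (isBounded_closedBall (x := (0 : 𝔼)) (r := |b| / t + 1)).subset ?_
  rintro y ⟨-, h2⟩
  rw [mem_closedBall_zero_iff]
  have h3 : ‖y‖ ^ 2 ≤ |b| / t := by
    rw [le_div_iff₀ ht]
    linarith [le_abs_self b]
  nlinarith [norm_nonneg y, sq_nonneg (‖y‖ - 1)]

theorem contDiff_radial_scaled {g : ℝ → ℝ} {k : WithTop ℕ∞} (hg : ContDiff ℝ k g) (t : ℝ) :
    ContDiff ℝ k fun y : 𝔼 => g (t * ‖y‖ ^ 2) :=
  hg.comp (contDiff_const.mul (contDiff_norm_sq ℝ))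

theorem integrable_radial_mul {a b t : ℝ} (ha : 0 < a) (hb : b < 1) {g : ℝ → ℝ}
    (hg : SmoothOff a b g) {u : 𝔼 → ℝ} (hu : ContinuousOn u (ball 0 1 \ {0})) (ht : 1 ≤ t) :
    Integrable fun y : 𝔼 => g (t * ‖y‖ ^ 2) * u y :=
  integrable_mul_of_tsupport_subset (isOpen_ball.sdiff isClosed_singleton)
    (contDiff_radial_scaled hg.1 t).continuous
    ((isCompact_annulus (by linarith)).of_isClosed_subset (isClosed_tsupport _)
      (tsupport_radial_subset hg t))
    ((tsupport_radial_subset hg t).trans (annulus_subset ha hb ht)) hu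

theorem hasDerivAt_radial_integral {a b t : ℝ} (ha : 0 < a) (hb : b < 1) {g : ℝ → ℝ}
    (hg : SmoothOff a b g) {u : 𝔼 → ℝ} (hu : ContinuousOn u (ball 0 1 \ {0})) (ht : 2 ≤ t) :
    HasDerivAt (fun t => ∫ y, g (t * ‖y‖ ^ 2) * u y)
      (t⁻¹ * ∫ y, (fun s => s * deriv g s) (t * ‖y‖ ^ 2) * u y) t := by
  obtain ⟨C, hC0, hC⟩ := hg.deriv.exists_bound
  set S : Set 𝔼 := {y : 𝔼 | 1 * ‖y‖ ^ 2 ∈ Icc (a / (t + 1)) b} with hS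
  have hSc : IsCompact S := isCompact_annulus one_pos
  have hSU : S ⊆ ball 0 1 \ {0} := annulus_subset (by positivity) hb le_rfl
  have key := hasDerivAt_integral_of_dominated_loc_of_deriv_le (μ := (volume : Measure 𝔼))
    (F := fun τ (y : 𝔼) => g (τ * ‖y‖ ^ 2) * u y) (x₀ := t) (s := ball t 1)
    (F' := fun τ y => (‖y‖ ^ 2 * deriv g (τ * ‖y‖ ^ 2)) * u y)
    (bound := S.indicator fun y => C * ‖u y‖) (ball_mem_nhds t one_pos) ?_ (integrable_radial_mul ha hb hg hu (by linarith))
    ?_ ?_ ?_ ?_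
  · refine key.2.congr_deriv ?_
    rw [← integral_const_mul]
    refine integral_congr_ae (Filter.Eventually.of_forall fun y => ?_)
    have : t ≠ 0 := by positivity
    simp only
    field_simp
  · filter_upwards [ball_mem_nhds t one_pos] with τ hτ
    rw [mem_ball, Real.dist_eq, abs_lt] at hτ
    exact (integrable_radial_mul ha hb hg hu (by linarith)).aestronglyMeasurable
  · have : (fun y : 𝔼 => (‖y‖ ^ 2 * deriv g (t * ‖y‖ ^ 2)) * u y) = fun y =>
        t⁻¹ * ((fun s => s * deriv g s) (t * ‖y‖ ^ 2) * u y) := by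
      funext y
      have : t ≠ 0 := by positivity
      simp only
      field_simp
    rw [this]
    exact ((integrable_radial_mul ha hb hg.deriv.id_mul hu (by linarith)).const_mul _).aestronglyMeasurable
  · refine Filter.Eventually.of_forall fun y τ hτ => ?_
    rw [mem_ball, Real.dist_eq, abs_lt] at hτ
    by_cases hy : y ∈ S
    · rw [indicator_of_mem hy, norm_mul]
      refine mul_le_mul_of_nonneg_right ?_ (norm_nonneg _)
      have h1 : ‖y‖ ^ 2 ≤ 1 := by
        have := hy.2
        linarith
      rw [Real.norm_eq_abs, abs_mul, abs_of_nonneg (sq_nonneg _)]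
      calc ‖y‖ ^ 2 * |deriv g (τ * ‖y‖ ^ 2)| ≤ 1 * C :=
            mul_le_mul h1 (hC _) (abs_nonneg _) zero_le_one
        _ = C := one_mul C
    · rw [indicator_of_notMem hy]
      have : deriv g (τ * ‖y‖ ^ 2) = 0 := by
        refine hg.deriv.2 _ fun hc => hy ⟨?_, ?_⟩
        · rw [div_le_iff₀ (by linarith)]
          nlinarith [hc.1, sq_nonneg ‖y‖]
        · nlinarith [hc.2, sq_nonneg ‖y‖]
      simp [this]
  · rw [integrable_indicator_iff hSc.measurableSet]
    exact (((hu.mono hSU).integrableOn_compact hSc).norm).const_mul C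
  · refine Filter.Eventually.of_forall fun y τ _ => ?_
    have h1 : HasDerivAt g (deriv g (τ * ‖y‖ ^ 2)) (τ * ‖y‖ ^ 2) :=
      ((hg.1.differentiable (by simp)) _).hasDerivAt
    have h2 : HasDerivAt (fun τ : ℝ => τ * ‖y‖ ^ 2) (‖y‖ ^ 2) τ := by
      simpa using (hasDerivAt_id τ).mul_const (‖y‖ ^ 2)
    have h3 := (h1.comp τ h2).mul_const (u y)
    rw [mul_comm (deriv g _)] at h3
    exact h3

theorem abs_le_rpow_of_euler_bound {f f' : ℝ → ℝ} {p C : ℝ} (hp : 1 ≤ p)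
    (hf : ∀ t, 2 ≤ t → HasDerivAt f (f' t) t)
    (h : ∀ t, 2 ≤ t → |t * f' t + p * f t| ≤ C * t ^ (-(1 / 2) : ℝ)) :
    ∃ D, ∀ t, 2 ≤ t → |f t| ≤ D * t ^ (-(1 / 2) : ℝ) := by
  have hC : 0 ≤ C := by
    have := (abs_nonneg _).trans (h 2 le_rfl)
    exact nonneg_of_mul_nonneg_left this (by positivity)
  set D := |f 2| * (2 : ℝ) ^ p + 2 * C with hD
  have hD0 : 0 ≤ D := by positivity
  refine ⟨D, fun t ht => ?_⟩
  have hd : ∀ s, 2 ≤ s → HasDerivAt (fun s => s ^ p * f s) (s ^ (p - 1) * (s * f' s + p * f s)) s := by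
    intro s hs
    have h1 := (Real.hasDerivAt_rpow_const (p := p) (Or.inl (by linarith : s ≠ 0))).mul (hf s hs)
    refine h1.congr_deriv ?_
    rw [show s ^ p = s ^ (p - 1) * s by
      rw [← rpow_add_one (by linarith : s ≠ 0)]; ring_nf]
    ring
  have hB : ∀ s, 2 ≤ s → HasDerivAt (fun s => D * s ^ (p - 1 / 2))
      (D * ((p - 1 / 2) * s ^ (p - 1 / 2 - 1))) s := fun s hs =>
    (Real.hasDerivAt_rpow_const (Or.inl (by linarith : s ≠ 0))).const_mul D
  have key := image_norm_le_of_norm_deriv_right_le_deriv_boundary'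
    (f := fun s => s ^ p * f s) (a := 2) (b := t)
    (f' := fun s => s ^ (p - 1) * (s * f' s + p * f s))
    (fun s hs => (hd s hs.1).continuousAt.continuousWithinAt)
    (fun s hs => (hd s hs.1).hasDerivWithinAt) (B := fun s => D * s ^ (p - 1 / 2))
    (B' := fun s => D * ((p - 1 / 2) * s ^ (p - 1 / 2 - 1))) ?_
    (fun s hs => (hB s hs.1).continuousAt.continuousWithinAt)
    (fun s hs => (hB s hs.1).hasDerivWithinAt) ?_ (x := t) ⟨ht, le_rfl⟩
  · have ht0 : 0 < t := by linarith
    rw [Real.norm_eq_abs, abs_mul, abs_of_pos (rpow_pos_of_pos ht0 p)] at key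
    have h1 : t ^ (p - 1 / 2) = t ^ p * t ^ (-(1 / 2) : ℝ) := by
      rw [← rpow_add ht0]; ring_nf
    rw [h1] at key
    have := rpow_pos_of_pos ht0 p
    refine le_of_mul_le_mul_left ?_ this
    linarith
  · rw [Real.norm_eq_abs, abs_mul, abs_of_pos (by positivity)]
    have h1 : (1 : ℝ) ≤ 2 ^ (p - 1 / 2) := one_le_rpow (by norm_num) (by linarith)
    have h2 : |f 2| * (2 : ℝ) ^ p ≤ D := by linarith
    calc _ = |f 2| * (2 : ℝ) ^ p := mul_comm _ _
      _ ≤ D * 1 := by linarith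
      _ ≤ _ := mul_le_mul_of_nonneg_left h1 hD0
  · intro s hs
    have hs0 : 0 < s := by linarith [hs.1]
    rw [Real.norm_eq_abs, abs_mul, abs_of_pos (rpow_pos_of_pos hs0 _)]
    have e : s ^ (p - 1 / 2 - 1) = s ^ (p - 1) * s ^ (-(1 / 2) : ℝ) := by
      rw [← rpow_add hs0]; ring_nf
    rw [e]
    have h3 : C ≤ D * (p - 1 / 2) := by
      have : 0 ≤ |f 2| * (2 : ℝ) ^ p := by positivity
      nlinarith
    calc s ^ (p - 1) * |s * f' s + p * f s| ≤ s ^ (p - 1) * (C * s ^ (-(1 / 2) : ℝ)) :=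
          mul_le_mul_of_nonneg_left (h s hs.1) (by positivity)
      _ = C * (s ^ (p - 1) * s ^ (-(1 / 2) : ℝ)) := by ring
      _ ≤ (D * (p - 1 / 2)) * (s ^ (p - 1) * s ^ (-(1 / 2) : ℝ)) :=
          mul_le_mul_of_nonneg_right h3 (by positivity)
      _ = _ := by ring

theorem lap_sq_mul_radial {a b t : ℝ} {g : ℝ → ℝ} (hg : SmoothOff a b g) (x : 𝔼) :
    lap (fun y : 𝔼 => ‖y‖ ^ 2 * g (t * ‖y‖ ^ 2)) x =
      8 * (t * ‖x‖ ^ 2) * deriv g (t * ‖x‖ ^ 2) + 4 * (t * ‖x‖ ^ 2) ^ 2 * deriv (deriv g) (t * ‖x‖ ^ 2)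
        + 2 * n * (t * ‖x‖ ^ 2) * deriv g (t * ‖x‖ ^ 2) + 2 * n * g (t * ‖x‖ ^ 2) := by
  have hd : ∀ {f : ℝ → ℝ}, SmoothOff a b f → ∀ q : ℝ,
      HasDerivAt (fun q => f (t * q)) (deriv f (t * q) * t) q := by
    intro f hf q
    have h1 : HasDerivAt f (deriv f (t * q)) (t * q) :=
      ((hf.1.differentiable (by simp)) _).hasDerivAt
    have h2 : HasDerivAt (fun q : ℝ => t * q) t q := by
      simpa using (hasDerivAt_id q).const_mul t
    exact h1.comp q h2
  have key := lap_radial (F := fun q => q * g (t * q))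
    (F₁ := fun q => g (t * q) + q * (deriv g (t * q) * t))
    (F₂ := fun q => 2 * t * deriv g (t * q) + q * t ^ 2 * deriv (deriv g) (t * q)) isOpen_univ
    (δ := 0) (x := x) ?_ ?_ (mem_univ _)
  · simp only [add_zero] at key
    rw [key]
    ring
  · intro q _
    refine ((hasDerivAt_id q).mul (hd hg q)).congr_deriv ?_
    simp
  · intro q _
    refine ((hd hg q).add ((hasDerivAt_id q).mul ((hd hg.deriv q).mul_const t))).congr_deriv ?_
    simp only [id]
    ring

theorem exists_radial_integral_bound (hn : 2 ≤ n) {a b : ℝ} (ha : 0 < a) (hb : b < 1) (k : ℕ)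
    {u : 𝔼 → ℝ} {g : ℝ → ℝ} (hu : ContDiffOn ℝ (2 * k : ℕ) u (ball 0 1 \ {0}))
    (h0 : ∀ x ∈ ball (0 : 𝔼) 1 \ {0}, nlapIter k u x = 0) (hg : SmoothOff a b g) :
    ∃ C, ∀ t, 2 ≤ t → |∫ y, g (t * ‖y‖ ^ 2) * u y| ≤ C * t ^ (-(1 / 2) : ℝ) := by
  have hU : IsOpen (ball (0 : 𝔼) 1 \ {0}) := isOpen_ball.sdiff isClosed_singleton
  induction k generalizing u g with
  | zero =>
    refine ⟨0, fun t ht => ?_⟩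
    have : (fun y : 𝔼 => g (t * ‖y‖ ^ 2) * u y) = fun _ => 0 := by
      funext y
      by_cases hy : y ∈ ball (0 : 𝔼) 1 \ {0}
      · rw [show u y = 0 from h0 y hy, mul_zero]
      · rw [hg.2 _ fun hc => hy (annulus_subset ha hb (by linarith) hc), zero_mul]
    simp [this]
  | succ k ih =>
    have huc := hu.continuousOn
    set g₁ : ℝ → ℝ := fun s => s * deriv g s + 1 * g s with hg₁
    have hs₁ : SmoothOff a b g₁ := hg.deriv.id_mul.add (hg.const_mul 1)
    set g₂ : ℝ → ℝ := fun s => s * deriv g₁ s + (n / 2 : ℝ) * g₁ s with hg₂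
    have hs₂ : SmoothOff a b g₂ := hs₁.deriv.id_mul.add (hs₁.const_mul _)
    obtain ⟨C, hC⟩ := ih (u := nlap u) (nlap_contDiffOn hU hu (by norm_cast)) 
      (fun x hx => by rw [← nlapIter_succ']; exact h0 x hx) hg.id_mul
    have hC' : ∀ t, 2 ≤ t → |∫ y, g₂ (t * ‖y‖ ^ 2) * u y| ≤ C * t ^ (-(1 / 2) : ℝ) := by
      intro t ht
      have ht0 : t ≠ 0 := by positivity
      have hsub : (fun y : 𝔼 => ‖y‖ ^ 2 * g (t * ‖y‖ ^ 2)) =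
          fun y => t⁻¹ * (fun s => s * g s) (t * ‖y‖ ^ 2) := by
        funext y
        simp only
        field_simp
      have hts : tsupport (fun y : 𝔼 => ‖y‖ ^ 2 * g (t * ‖y‖ ^ 2)) ⊆ {y | t * ‖y‖ ^ 2 ∈ Icc a b} := by
        rw [hsub]
        exact tsupport_radial_subset (hg.id_mul.const_mul _) t
      have hd : ∀ s, deriv g₁ s = 2 * deriv g s + s * deriv (deriv g) s := by
        intro s
        have h1 := ((hg.1.differentiable (by simp)) s).hasDerivAt
        have h2 := ((hg.deriv.1.differentiable (by simp)) s).hasDerivAt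
        refine ((((hasDerivAt_id s).mul h2).add (h1.const_mul 1)).congr_deriv ?_).deriv
        simp only [id]
        ring
      have hlap : ∀ y : 𝔼, g₂ (t * ‖y‖ ^ 2) =
          -(1 / 4) * nlap (fun y : 𝔼 => ‖y‖ ^ 2 * g (t * ‖y‖ ^ 2)) y := by
        intro y
        rw [nlap, lap_sq_mul_radial hg]
        change t * ‖y‖ ^ 2 * deriv g₁ (t * ‖y‖ ^ 2) + (n / 2 : ℝ) * g₁ (t * ‖y‖ ^ 2) = _
        rw [hd]
        simp only [hg₁]
        ring
      have e1 : ∫ y, g₂ (t * ‖y‖ ^ 2) * u y =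
          -(1 / 4) * (t⁻¹ * ∫ y, (fun s => s * g s) (t * ‖y‖ ^ 2) * nlap u y) := by
        have hP := integral_mul_nlap hU
          ((contDiff_norm_sq ℝ).mul (contDiff_radial_scaled (hg.1.of_le ENat.LEInfty.out) t))
          ((isCompact_annulus (by linarith)).of_isClosed_subset (isClosed_tsupport _) hts)
          (hts.trans (annulus_subset ha hb (by linarith))) (hu.of_le (by norm_cast; omega))
        have hQ : (fun y => g₂ (t * ‖y‖ ^ 2) * u y) = fun y =>
            -(1 / 4) * (nlap (fun y : 𝔼 => ‖y‖ ^ 2 * g (t * ‖y‖ ^ 2)) y * u y) := by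
          funext y
          rw [hlap, mul_assoc]
        rw [hQ, integral_const_mul, ← hP, ← integral_const_mul t⁻¹]
        congr 2
        funext y
        field_simp
      rw [e1, abs_mul, abs_mul, abs_inv, abs_of_pos (by linarith : 0 < t)]
      have h1 := hC t ht
      have h2 : t⁻¹ ≤ 1 := inv_le_one_of_one_le₀ (by linarith)
      have h3 : 0 ≤ t⁻¹ := by positivity
      have h4 := abs_nonneg (∫ y, (fun s => s * g s) (t * ‖y‖ ^ 2) * nlap u y)
      rw [show |(-(1 / 4) : ℝ)| = 1 / 4 by rw [abs_neg, abs_of_pos] <;> norm_num]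
      nlinarith [mul_nonneg h3 h4, mul_nonneg (sub_nonneg.2 h2) h4]
    have step : ∀ {f : ℝ → ℝ} (p : ℝ), SmoothOff a b f → ∀ t, 2 ≤ t →
        t * (t⁻¹ * ∫ y, (fun s => s * deriv f s) (t * ‖y‖ ^ 2) * u y)
          + p * ∫ y, f (t * ‖y‖ ^ 2) * u y
        = ∫ y, (fun s => s * deriv f s + p * f s) (t * ‖y‖ ^ 2) * u y := by
      intro f p hf t ht
      rw [mul_inv_cancel_left₀ (by positivity), ← integral_const_mul, ← integral_add
        (integrable_radial_mul ha hb hf.deriv.id_mul huc (by linarith))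
        ((integrable_radial_mul ha hb hf huc (by linarith)).const_mul p)]
      congr 1
      funext y
      ring
    obtain ⟨C₁, hC₁⟩ := abs_le_rpow_of_euler_bound (p := n / 2) (C := C)
      (by rw [le_div_iff₀ two_pos]; exact_mod_cast hn)
      (fun t ht => hasDerivAt_radial_integral ha hb hs₁ huc ht)
      (fun t ht => by rw [step _ hs₁ t ht]; exact hC' t ht)
    exact abs_le_rpow_of_euler_bound (p := 1) (C := C₁) le_rfl
      (fun t ht => hasDerivAt_radial_integral ha hb hg huc ht)
      (fun t ht => by rw [step _ hg t ht]; exact hC₁ t ht)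

/-- A smooth antitone cutoff, equal to `1` on `(-∞, 1/4]` and to `0` on `[1/2, ∞)`. -/
def lineCutoff (q : ℝ) : ℝ := smoothTransition (2 - 4 * q)

theorem lineCutoff_eq_one {q : ℝ} (h : q ≤ 1 / 4) : lineCutoff q = 1 :=
  smoothTransition.one_of_one_le (by linarith)

theorem lineCutoff_eq_zero {q : ℝ} (h : 1 / 2 ≤ q) : lineCutoff q = 0 :=
  smoothTransition.zero_of_nonpos (by linarith)

theorem smoothOff_lineCutoff_sub :
    SmoothOff (1 / 16) (1 / 2) fun q => lineCutoff q - lineCutoff (4 * q) := by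
  have h : ContDiff ℝ (⊤ : ℕ∞) lineCutoff :=
    smoothTransition.contDiff.comp (contDiff_const.sub (contDiff_const.mul contDiff_id))
  refine ⟨h.sub (h.comp (contDiff_const.mul contDiff_id)), fun q hq => ?_⟩
  simp only
  rw [mem_Icc, not_and_or, not_le, not_le] at hq
  rcases hq with hq | hq
  · rw [lineCutoff_eq_one (by linarith), lineCutoff_eq_one (by linarith), sub_self]
  · rw [lineCutoff_eq_zero (by linarith), lineCutoff_eq_zero (by linarith), sub_self]

theorem integrableOn_of_integrableOn_posPart (hn : 2 ≤ n) {m : ℕ} {u : 𝔼 → ℝ}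
    (hu : ContDiffOn ℝ (2 * m : ℕ) u (ball 0 1 \ {0}))
    (h0 : ∀ x ∈ ball (0 : 𝔼) 1 \ {0}, nlapIter m u x = 0)
    (hp : IntegrableOn (fun x => max (u x) 0) (ball (0 : 𝔼) 1 \ {0})) :
    IntegrableOn u (ball (0 : 𝔼) (1 / 4) \ {0}) := by
  have huc := hu.continuousOn
  have hU : IsOpen (ball (0 : 𝔼) 1 \ {0}) := isOpen_ball.sdiff isClosed_singleton
  have ha : (0 : ℝ) < 1 / 16 := by norm_num
  have hb : (1 / 2 : ℝ) < 1 := by norm_num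
  set g : ℝ → ℝ := fun q => lineCutoff q - lineCutoff (4 * q) with hgdef
  have hg : SmoothOff (1 / 16) (1 / 2) g := smoothOff_lineCutoff_sub
  have hg0 : ∀ q, 0 ≤ q → 0 ≤ g q := fun q hq =>
    sub_nonneg.2 (smoothTransition.monotone (by linarith))
  obtain ⟨C, hC⟩ := exists_radial_integral_bound hn ha hb m hu h0 hg
  have hC0 : 0 ≤ C := nonneg_of_mul_nonneg_left ((abs_nonneg _).trans (hC 2 le_rfl)) (by positivity)
  set P : ℕ → 𝔼 → ℝ := fun N y => ∑ k ∈ Finset.range N, g (2 * 4 ^ k * ‖y‖ ^ 2) with hP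
  have ht : ∀ k : ℕ, (2 : ℝ) ≤ 2 * 4 ^ k := fun k => by
    linarith [one_le_pow₀ (by norm_num : (1 : ℝ) ≤ 4) (n := k)]
  have hPtel : ∀ N y, P N y = lineCutoff (2 * ‖y‖ ^ 2) - lineCutoff (2 * 4 ^ N * ‖y‖ ^ 2) := by
    intro N y
    induction N with
    | zero => simp [hP]
    | succ N ih =>
      rw [show P (N + 1) y = P N y + g (2 * 4 ^ N * ‖y‖ ^ 2) from Finset.sum_range_succ _ _, ih]
      simp only [hgdef]
      rw [show 4 * (2 * 4 ^ N * ‖y‖ ^ 2) = 2 * 4 ^ (N + 1) * ‖y‖ ^ 2 by ring]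
      ring
  have hP0 : ∀ N y, 0 ≤ P N y := fun N y => Finset.sum_nonneg fun k _ => hg0 _ (by positivity)
  have hP1 : ∀ N y, P N y ≤ 1 := fun N y => by
    rw [hPtel]
    have h1 := smoothTransition.le_one (2 - 4 * (2 * ‖y‖ ^ 2))
    have h2 := smoothTransition.nonneg (2 - 4 * (2 * 4 ^ N * ‖y‖ ^ 2))
    unfold lineCutoff
    linarith
  have hPU : ∀ N y, y ∉ ball (0 : 𝔼) 1 \ {0} → P N y = 0 := fun N y hy =>
    Finset.sum_eq_zero fun k _ => hg.2 _ fun hc =>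
      hy (annulus_subset ha hb (by linarith [ht k]) hc)
  have hPi : ∀ {v : 𝔼 → ℝ}, ContinuousOn v (ball 0 1 \ {0}) → ∀ N,
      Integrable fun y => P N y * v y := by
    intro v hv N
    simp only [hP, Finset.sum_mul]
    exact integrable_finsetSum _ fun k _ => integrable_radial_mul ha hb hg hv (by linarith [ht k])
  have hlow : ∀ N, |∫ y, P N y * u y| ≤ C * 2 := by
    intro N
    have e : ∫ y, P N y * u y = ∑ k ∈ Finset.range N, ∫ y, g (2 * 4 ^ k * ‖y‖ ^ 2) * u y := by
      simp only [hP, Finset.sum_mul]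
      exact integral_finsetSum _ fun k _ =>
        integrable_radial_mul ha hb hg huc (by linarith [ht k])
    rw [e]
    refine (Finset.abs_sum_le_sum_abs _ _).trans ?_
    calc ∑ k ∈ Finset.range N, |∫ y, g (2 * 4 ^ k * ‖y‖ ^ 2) * u y|
        ≤ ∑ k ∈ Finset.range N, C * (1 / 2) ^ k := Finset.sum_le_sum fun k _ => by
          refine (hC _ (ht k)).trans (mul_le_mul_of_nonneg_left ?_ hC0)
          calc (2 * 4 ^ k : ℝ) ^ (-(1 / 2) : ℝ) ≤ ((2 ^ k) ^ 2 : ℝ) ^ (-(1 / 2) : ℝ) := by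
                refine rpow_le_rpow_of_nonpos (by positivity) ?_ (by norm_num)
                rw [← pow_mul, mul_comm k, pow_mul]
                norm_num
            _ = (1 / 2) ^ k := by
                rw [← rpow_natCast (2 ^ k : ℝ) 2, ← rpow_mul (by positivity)]
                norm_num [rpow_neg_one]
                rw [one_div, inv_pow]
      _ = C * ∑ k ∈ Finset.range N, (1 / 2) ^ k := by rw [Finset.mul_sum]
      _ ≤ C * 2 := mul_le_mul_of_nonneg_left (sum_geometric_two_le N) hC0
  set I := ∫ y in ball (0 : 𝔼) 1 \ {0}, max (u y) 0 with hI
  have hpos : ∀ N, ∫ y, P N y * max (u y) 0 ≤ I := by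
    intro N
    rw [hI, ← integral_indicator hU.measurableSet]
    refine integral_mono_of_nonneg (Filter.Eventually.of_forall fun y =>
      mul_nonneg (hP0 N y) (le_max_right _ _)) (hp.integrable_indicator hU.measurableSet)
      (Filter.Eventually.of_forall fun y => ?_)
    by_cases hy : y ∈ ball (0 : 𝔼) 1 \ {0}
    · simp only [indicator_of_mem hy]
      exact mul_le_of_le_one_left (le_max_right _ _) (hP1 N y)
    · simp only [indicator_of_notMem hy, hPU N y hy, zero_mul, le_refl]
  have habs : ∀ N, ∫ y, P N y * |u y| ≤ 2 * I + C * 2 := by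
    intro N
    have e : (fun y => P N y * |u y|) = fun y => 2 * (P N y * max (u y) 0) - P N y * u y := by
      funext y
      rcases le_total 0 (u y) with h | h
      · rw [abs_of_nonneg h, max_eq_left h]; ring
      · rw [abs_of_nonpos h, max_eq_right h]; ring
    rw [e, integral_sub ((hPi (huc.sup continuousOn_const) N).const_mul 2) (hPi huc N),
      integral_const_mul]
    have := (abs_le.1 (hlow N)).1
    linarith [hpos N]
  have hV : MeasurableSet (ball (0 : 𝔼) (1 / 4) \ {0}) :=
    (isOpen_ball.sdiff isClosed_singleton).measurableSet
  set A : ℕ → Set 𝔼 := fun N => {y | 1 ≤ 4 * 4 ^ N * ‖y‖ ^ 2} with hA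
  have hAm : ∀ N, MeasurableSet (A N) := fun N =>
    (isClosed_le continuous_const (by fun_prop)).measurableSet
  have hPA : ∀ N, ∀ y ∈ A N ∩ (ball (0 : 𝔼) (1 / 4) \ {0}), P N y = 1 := by
    rintro N y ⟨h1, h2, -⟩
    rw [mem_ball_zero_iff] at h2
    have h1' : 1 ≤ 4 * 4 ^ N * ‖y‖ ^ 2 := h1
    rw [hPtel, lineCutoff_eq_one (by nlinarith [norm_nonneg y]),
      lineCutoff_eq_zero (by linarith), sub_zero]
  have hle : ∀ N y, (A N ∩ (ball (0 : 𝔼) (1 / 4) \ {0})).indicator (fun y => |u y|) y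
      ≤ P N y * |u y| := by
    intro N y
    by_cases hy : y ∈ A N ∩ (ball (0 : 𝔼) (1 / 4) \ {0})
    · rw [indicator_of_mem hy, hPA N y hy, one_mul]
    · rw [indicator_of_notMem hy]
      exact mul_nonneg (hP0 N y) (abs_nonneg _)
  have cover : AECover (volume.restrict (ball (0 : 𝔼) (1 / 4) \ {0})) Filter.atTop A := by
    refine ⟨?_, hAm⟩
    filter_upwards [ae_restrict_mem hV] with y hy
    have hy0 : 0 < ‖y‖ ^ 2 := by
      have : y ≠ 0 := hy.2
      positivity
    obtain ⟨N₀, hN₀⟩ := pow_unbounded_of_one_lt (‖y‖ ^ 2)⁻¹ (by norm_num : (1 : ℝ) < 4)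
    filter_upwards [Filter.eventually_ge_atTop N₀] with N hN
    change 1 ≤ 4 * 4 ^ N * ‖y‖ ^ 2
    have h1 : (‖y‖ ^ 2)⁻¹ ≤ 4 ^ N := hN₀.le.trans (pow_le_pow_right₀ (by norm_num) hN)
    rw [inv_le_iff_one_le_mul₀ hy0] at h1
    nlinarith
  refine cover.integrable_of_integral_norm_bounded (2 * I + C * 2) (fun N => ?_)
    (Filter.Eventually.of_forall fun N => ?_)
  · rw [IntegrableOn, Measure.restrict_restrict (hAm N)]
    rw [← IntegrableOn, ← integrable_indicator_iff ((hAm N).inter hV)]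
    refine ((hPi huc N).indicator ((hAm N).inter hV)).congr (Filter.Eventually.of_forall fun y => ?_)
    by_cases hy : y ∈ A N ∩ (ball (0 : 𝔼) (1 / 4) \ {0})
    · simp only [indicator_of_mem hy, hPA N y hy, one_mul]
    · simp only [indicator_of_notMem hy]
  · rw [Measure.restrict_restrict (hAm N), ← integral_indicator ((hAm N).inter hV)]
    refine (integral_mono_of_nonneg (Filter.Eventually.of_forall fun y => ?_) (hPi huc.abs N)
      (Filter.Eventually.of_forall (hle N))).trans (habs N)
    exact indicator_nonneg (fun y _ => abs_nonneg _) y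

/-- The homogeneous Taylor polynomial of degree `k` of `v` at the origin. -/
def taylorTerm {n : ℕ} : ℕ → (EuclideanSpace ℝ (Fin n) → ℝ) → EuclideanSpace ℝ (Fin n) → ℝ
  | 0, v, _ => v 0
  | k + 1, v, y => ((k : ℝ) + 1)⁻¹ * ∑ i, y i * taylorTerm k (pderiv1 i v) y

/-- The remainder of the Taylor expansion at the origin of order `N`. -/
def taylorRem {n : ℕ} (N : ℕ) (v : EuclideanSpace ℝ (Fin n) → ℝ) (y : EuclideanSpace ℝ (Fin n)) :
    ℝ :=
  v y - ∑ k ∈ Finset.range N, taylorTerm k v y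

theorem taylorTerm_congr {U : Set 𝔼} (hU : IsOpen U) (h0 : (0 : 𝔼) ∈ U) (k : ℕ) {v w : 𝔼 → ℝ}
    (h : EqOn v w U) : taylorTerm k v = taylorTerm k w := by
  induction k generalizing v w with
  | zero => funext y; exact h h0
  | succ k ih =>
    funext y
    simp only [taylorTerm, fun i => ih (pderiv1_eqOn hU h i)]

theorem contDiff_taylorTerm {l : WithTop ℕ∞} (k : ℕ) (v : 𝔼 → ℝ) :
    ContDiff ℝ l (taylorTerm k v) := by
  induction k generalizing v with
  | zero => exact contDiff_const
  | succ k ih =>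
    exact contDiff_const.mul (ContDiff.sum fun i _ => ContDiff.mul (by fun_prop) (ih _))

theorem taylorTerm_succ_zero (k : ℕ) (v : 𝔼 → ℝ) : taylorTerm (k + 1) v 0 = 0 := by
  simp [taylorTerm]

theorem infty_add_one_le : ((⊤ : ℕ∞) : WithTop ℕ∞) + 1 ≤ ((⊤ : ℕ∞) : WithTop ℕ∞) := le_rfl

theorem pderiv1_taylorTerm_succ {U : Set 𝔼} (hU : IsOpen U) (h0 : (0 : 𝔼) ∈ U) (k : ℕ) {v : 𝔼 → ℝ}
    (hv : ContDiffOn ℝ (⊤ : ℕ∞) v U) (j : Fin n) (y : 𝔼) :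
    pderiv1 j (taylorTerm (k + 1) v) y = taylorTerm k (pderiv1 j v) y := by
  have hd : ∀ (k : ℕ) (v : 𝔼 → ℝ), DifferentiableAt ℝ (taylorTerm k v) y := fun k v =>
    (contDiff_taylorTerm (l := 1) k v).differentiable (by simp) y
  have hc : ∀ i, DifferentiableAt ℝ (fun y : 𝔼 => y i) y := fun i => by fun_prop
  have step : ∀ (k : ℕ) (v : 𝔼 → ℝ), pderiv1 j (taylorTerm (k + 1) v) y =
      ((k : ℝ) + 1)⁻¹ * (taylorTerm k (pderiv1 j v) y
        + ∑ i, y i * pderiv1 j (taylorTerm k (pderiv1 i v)) y) := by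
    intro k v
    have e : taylorTerm (k + 1) v =
        fun y => ((k : ℝ) + 1)⁻¹ * ∑ i, y i * taylorTerm k (pderiv1 i v) y := rfl
    rw [e, pderiv1_const_mul]
    simp only
    rw [pderiv1_sum (f := fun i y => y i * taylorTerm k (pderiv1 i v) y)
      fun i _ => (hc i).mul (hd _ _)]
    simp_rw [pderiv1_mul (hc _) (hd _ _), pderiv1_coord, Finset.sum_add_distrib]
    simp
  induction k generalizing v with
  | zero =>
    rw [step]
    have : ∀ i, pderiv1 j (taylorTerm 0 (pderiv1 i v)) y = 0 := fun i => by
      have e : taylorTerm 0 (pderiv1 i v) = fun _ => pderiv1 i v 0 := rfl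
      simp [pderiv1, e]
    simp [this]
  | succ k ih =>
    rw [step]
    have h1 : ∀ i, pderiv1 j (taylorTerm (k + 1) (pderiv1 i v)) y
        = taylorTerm k (pderiv1 i (pderiv1 j v)) y := fun i => by
      rw [ih (pderiv1_contDiffOn hU hv infty_add_one_le i), taylorTerm_congr hU h0 k
        (pderiv1_comm hU (hv.of_le ENat.LEInfty.out) j i)]
    simp only [h1]
    have h2 : ∑ i, y i * taylorTerm k (pderiv1 i (pderiv1 j v)) y
        = ((k : ℝ) + 1) * taylorTerm (k + 1) (pderiv1 j v) y := by
      simp only [taylorTerm]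
      rw [mul_inv_cancel_left₀ (by positivity)]
    rw [h2]
    push_cast
    have : (k : ℝ) + 1 + 1 ≠ 0 := by positivity
    field_simp
    ring

theorem pderiv1_taylorRem_succ {U : Set 𝔼} (hU : IsOpen U) (h0 : (0 : 𝔼) ∈ U) (N : ℕ) {v : 𝔼 → ℝ}
    (hv : ContDiffOn ℝ (⊤ : ℕ∞) v U) (j : Fin n) :
    EqOn (pderiv1 j (taylorRem (N + 1) v)) (taylorRem N (pderiv1 j v)) U := by
  intro y hy
  have hd : ∀ (k : ℕ) (v : 𝔼 → ℝ), DifferentiableAt ℝ (taylorTerm k v) y := fun k v =>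
    (contDiff_taylorTerm (l := 1) k v).differentiable (by simp) y
  have hvd : DifferentiableAt ℝ v y :=
    (hv.contDiffAt (hU.mem_nhds hy)).differentiableAt (by simp)
  have e : taylorRem (N + 1) v = fun y => v y - ∑ k ∈ Finset.range (N + 1), taylorTerm k v y := rfl
  rw [e, pderiv1_sub hvd (DifferentiableAt.fun_sum fun k _ => hd _ _),
    pderiv1_sum fun k _ => hd _ _, Finset.sum_range_succ']
  have h1 : pderiv1 j (taylorTerm 0 v) y = 0 := by
    have e : taylorTerm 0 v = fun _ => v 0 := rfl
    simp [pderiv1, e]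
  simp only [pderiv1_taylorTerm_succ hU h0 _ hv, h1, add_zero, taylorRem]

theorem contDiffOn_taylorRem {U : Set 𝔼} {l : WithTop ℕ∞} (N : ℕ) {v : 𝔼 → ℝ}
    (hv : ContDiffOn ℝ l v U) : ContDiffOn ℝ l (taylorRem N v) U :=
  hv.sub (ContDiffOn.sum fun k _ => (contDiff_taylorTerm k v).contDiffOn)

theorem taylorRem_succ_zero (N : ℕ) (v : 𝔼 → ℝ) : taylorRem (N + 1) v 0 = 0 := by
  simp only [taylorRem, Finset.sum_range_succ', taylorTerm_succ_zero]
  simp [taylorTerm]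

theorem norm_fderiv_le_sum_pderiv1 (f : 𝔼 → ℝ) (x : 𝔼) :
    ‖fderiv ℝ f x‖ ≤ ∑ i, |pderiv1 i f x| := by
  refine ContinuousLinearMap.opNorm_le_bound _ (Finset.sum_nonneg fun i _ => abs_nonneg _)
    fun y => ?_
  have hy : y = ∑ i, y i • EuclideanSpace.single i (1 : ℝ) := by
    have := (EuclideanSpace.basisFun (Fin n) ℝ).sum_repr y
    simpa using this.symm
  conv_lhs => rw [hy]
  rw [map_sum, Finset.sum_mul]
  refine (norm_sum_le _ _).trans (Finset.sum_le_sum fun i _ => ?_)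
  rw [map_smul, norm_smul, mul_comm]
  exact mul_le_mul_of_nonneg_left (PiLp.norm_apply_le y i) (abs_nonneg _)

theorem exists_taylorRem_bound {r ρ : ℝ} (hρ : ρ < r) (hρ0 : 0 ≤ ρ) (N : ℕ) {v : 𝔼 → ℝ}
    (hv : ContDiffOn ℝ (⊤ : ℕ∞) v (ball 0 r)) :
    ∃ C, 0 ≤ C ∧ ∀ y ∈ closedBall (0 : 𝔼) ρ, |taylorRem N v y| ≤ C * ‖y‖ ^ N := by
  have h0 : (0 : 𝔼) ∈ ball (0 : 𝔼) r := mem_ball_self (by linarith)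
  induction N generalizing v with
  | zero =>
    obtain ⟨C, hC⟩ := (isCompact_closedBall (0 : 𝔼) ρ).exists_bound_of_continuousOn
      (hv.continuousOn.mono (closedBall_subset_ball hρ))
    refine ⟨C, (norm_nonneg _).trans (hC 0 (mem_closedBall_self hρ0)), fun y hy => ?_⟩
    simpa [taylorRem] using hC y hy
  | succ N ih =>
    choose C hC0 hC using fun i => ih (pderiv1_contDiffOn isOpen_ball hv infty_add_one_le i)
    refine ⟨∑ i, C i, Finset.sum_nonneg fun i _ => hC0 i, fun y hy => ?_⟩
    rw [mem_closedBall_zero_iff] at hy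
    have hsub : closedBall (0 : 𝔼) ‖y‖ ⊆ ball 0 r := closedBall_subset_ball (by linarith)
    have key := (convex_closedBall (0 : 𝔼) ‖y‖).norm_image_sub_le_of_norm_fderiv_le
      (f := taylorRem (N + 1) v) (C := (∑ i, C i) * ‖y‖ ^ N) (𝕜 := ℝ) (fun z hz =>
        ((contDiffOn_taylorRem (N + 1) hv).contDiffAt
          (isOpen_ball.mem_nhds (hsub hz))).differentiableAt (by simp)) (fun z hz => by
        refine (norm_fderiv_le_sum_pderiv1 _ _).trans ?_
        rw [Finset.sum_mul]
        refine Finset.sum_le_sum fun i _ => ?_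
        rw [pderiv1_taylorRem_succ isOpen_ball h0 N hv i (hsub hz)]
        rw [mem_closedBall_zero_iff] at hz
        refine (hC i z (by rw [mem_closedBall_zero_iff]; linarith)).trans ?_
        exact mul_le_mul_of_nonneg_left (pow_le_pow_left₀ (norm_nonneg _) hz N) (hC0 i))
      (mem_closedBall_self (norm_nonneg y)) (y := y) (by simp)
    rw [taylorRem_succ_zero, sub_zero, sub_zero, Real.norm_eq_abs] at key
    rw [pow_succ, ← mul_assoc]
    exact key

/-- The family `F` and its derivatives of order `l ≤ k` are `O(ε ^ (a - l))` on `ball 0 (5 * ε)`. -/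
def ScaleBound {n : ℕ} (ρ : ℝ) : ℕ → ℤ → (ℝ → EuclideanSpace ℝ (Fin n) → ℝ) → Prop
  | 0, a, F => ∃ C, ∀ ε, 0 < ε → ε ≤ ρ → ∀ y ∈ ball 0 (5 * ε), |F ε y| ≤ C * ε ^ a
  | k + 1, a, F => (∀ ε, 0 < ε → ε ≤ ρ → ∀ y ∈ ball 0 (5 * ε), DifferentiableAt ℝ (F ε) y) ∧
      (∃ C, ∀ ε, 0 < ε → ε ≤ ρ → ∀ y ∈ ball 0 (5 * ε), |F ε y| ≤ C * ε ^ a) ∧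
      ∀ i, ScaleBound ρ k (a - 1) fun ε => pderiv1 i (F ε)

namespace ScaleBound

variable {ρ : ℝ} {k : ℕ} {a b : ℤ} {F G : ℝ → EuclideanSpace ℝ (Fin n) → ℝ}

theorem bound (h : ScaleBound ρ k a F) :
    ∃ C, ∀ ε, 0 < ε → ε ≤ ρ → ∀ y ∈ ball 0 (5 * ε), |F ε y| ≤ C * ε ^ a := by
  cases k with
  | zero => exact h
  | succ k => exact h.2.1

theorem of_succ (h : ScaleBound ρ (k + 1) a F) : ScaleBound ρ k a F := by
  induction k generalizing a F with
  | zero => exact h.2.1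
  | succ k ih => exact ⟨h.1, h.2.1, fun i => ih (h.2.2 i)⟩

theorem congr (h : ScaleBound ρ k a F)
    (hFG : ∀ ε, 0 < ε → ε ≤ ρ → EqOn (G ε) (F ε) (ball 0 (5 * ε))) : ScaleBound ρ k a G := by
  have hb : ∃ C, ∀ ε, 0 < ε → ε ≤ ρ → ∀ y ∈ ball 0 (5 * ε), |G ε y| ≤ C * ε ^ a := by
    obtain ⟨C, hC⟩ := h.bound
    exact ⟨C, fun ε h1 h2 y hy => by rw [hFG ε h1 h2 hy]; exact hC ε h1 h2 y hy⟩
  induction k generalizing a F G with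
  | zero => exact hb
  | succ k ih =>
    refine ⟨fun ε h1 h2 y hy => ?_, hb, fun i => ?_⟩
    · exact (h.1 ε h1 h2 y hy).congr_of_eventuallyEq
        ((hFG ε h1 h2).eventuallyEq_of_mem (isOpen_ball.mem_nhds hy))
    · have hFG' : ∀ ε, 0 < ε → ε ≤ ρ →
          EqOn (pderiv1 i (G ε)) (pderiv1 i (F ε)) (ball 0 (5 * ε)) :=
        fun ε h1 h2 => pderiv1_eqOn isOpen_ball (hFG ε h1 h2) i
      obtain ⟨C, hC⟩ := (h.2.2 i).bound
      exact ih (h.2.2 i) hFG'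
        ⟨C, fun ε h1 h2 y hy => by rw [hFG' ε h1 h2 hy]; exact hC ε h1 h2 y hy⟩

theorem add (hF : ScaleBound ρ k a F) (hG : ScaleBound ρ k a G) :
    ScaleBound ρ k a fun ε y => F ε y + G ε y := by
  have hb : ∀ {a : ℤ} {F G : ℝ → 𝔼 → ℝ} {k l : ℕ}, ScaleBound ρ k a F → ScaleBound ρ l a G →
      ∃ C, ∀ ε, 0 < ε → ε ≤ ρ → ∀ y ∈ ball 0 (5 * ε), |F ε y + G ε y| ≤ C * ε ^ a := by
    intro a F G k l hF hG
    obtain ⟨C, hC⟩ := hF.bound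
    obtain ⟨D, hD⟩ := hG.bound
    refine ⟨C + D, fun ε h1 h2 y hy => (abs_add_le _ _).trans ?_⟩
    rw [add_mul]
    exact _root_.add_le_add (hC ε h1 h2 y hy) (hD ε h1 h2 y hy)
  induction k generalizing a F G with
  | zero => exact hb (k := 0) (l := 0) hF hG
  | succ k ih =>
    refine ⟨fun ε h1 h2 y hy => (hF.1 ε h1 h2 y hy).add (hG.1 ε h1 h2 y hy), hb hF hG,
      fun i => (ih (hF.2.2 i) (hG.2.2 i)).congr fun ε h1 h2 y hy => ?_⟩
    exact pderiv1_add (hF.1 ε h1 h2 y hy) (hG.1 ε h1 h2 y hy) i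

theorem mul (hF : ScaleBound ρ k a F) (hG : ScaleBound ρ k b G) :
    ScaleBound ρ k (a + b) fun ε y => F ε y * G ε y := by
  have hb : ∀ {a b : ℤ} {F G : ℝ → 𝔼 → ℝ} {k l : ℕ}, ScaleBound ρ k a F → ScaleBound ρ l b G →
      ∃ C, ∀ ε, 0 < ε → ε ≤ ρ → ∀ y ∈ ball 0 (5 * ε), |F ε y * G ε y| ≤ C * ε ^ (a + b) := by
    intro a b F G k l hF hG
    obtain ⟨C, hC⟩ := hF.bound
    obtain ⟨D, hD⟩ := hG.bound
    refine ⟨C * D, fun ε h1 h2 y hy => ?_⟩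
    rw [abs_mul, zpow_add₀ h1.ne']
    calc |F ε y| * |G ε y| ≤ (C * ε ^ a) * (D * ε ^ b) :=
          mul_le_mul (hC ε h1 h2 y hy) (hD ε h1 h2 y hy) (abs_nonneg _)
            ((abs_nonneg _).trans (hC ε h1 h2 y hy))
      _ = _ := by ring
  induction k generalizing a b F G with
  | zero => exact hb (k := 0) (l := 0) hF hG
  | succ k ih =>
    refine ⟨fun ε h1 h2 y hy => (hF.1 ε h1 h2 y hy).mul (hG.1 ε h1 h2 y hy), hb hF hG,
      fun i => ?_⟩
    have h1 := ih (hF.2.2 i) hG.of_succ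
    have h2 := ih hF.of_succ (hG.2.2 i)
    rw [show a - 1 + b = a + b - 1 by ring] at h1
    rw [show a + (b - 1) = a + b - 1 by ring] at h2
    exact (h1.add h2).congr fun ε h1 h2 y hy =>
      pderiv1_mul (hF.1 ε h1 h2 y hy) (hG.1 ε h1 h2 y hy) i

theorem neg (hF : ScaleBound ρ k a F) : ScaleBound ρ k a fun ε y => -F ε y := by
  have hb : ∀ {a : ℤ} {F : ℝ → 𝔼 → ℝ} {k : ℕ}, ScaleBound ρ k a F →
      ∃ C, ∀ ε, 0 < ε → ε ≤ ρ → ∀ y ∈ ball 0 (5 * ε), |-F ε y| ≤ C * ε ^ a := by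
    intro a F k hF
    obtain ⟨C, hC⟩ := hF.bound
    exact ⟨C, fun ε h1 h2 y hy => by rw [abs_neg]; exact hC ε h1 h2 y hy⟩
  induction k generalizing a F with
  | zero => exact hb (k := 0) hF
  | succ k ih =>
    refine ⟨fun ε h1 h2 y hy => (hF.1 ε h1 h2 y hy).neg, hb hF, fun i => ?_⟩
    simp only [pderiv1_neg]
    exact ih (hF.2.2 i)

theorem zero : ScaleBound ρ k a fun _ (_ : 𝔼) => 0 := by
  have hb : ∀ a : ℤ, ∃ C : ℝ, ∀ ε, 0 < ε → ε ≤ ρ → ∀ y ∈ ball (0 : 𝔼) (5 * ε),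
      |(0 : ℝ)| ≤ C * ε ^ a := fun a => ⟨0, by simp⟩
  induction k generalizing a with
  | zero => exact hb a
  | succ k ih =>
    refine ⟨fun ε _ _ y _ => differentiableAt_const _, hb a, fun i => ?_⟩
    have : pderiv1 i (fun _ : 𝔼 => (0 : ℝ)) = fun _ => 0 := by funext y; simp [pderiv1]
    simp only [this]
    exact ih

theorem sum {ι : Type*} (s : Finset ι) {H : ι → ℝ → 𝔼 → ℝ} (h : ∀ i, ScaleBound ρ k a (H i)) :
    ScaleBound ρ k a fun ε y => ∑ i ∈ s, H i ε y := by
  classical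
  induction s using Finset.induction_on with
  | empty => simpa using zero
  | insert j s hj ih =>
    simp only [Finset.sum_insert hj]
    exact (h j).add ih

theorem nlap (hF : ScaleBound ρ (k + 2) a F) : ScaleBound ρ k (a - 2) fun ε => nlap (F ε) := by
  have h : ∀ i, ScaleBound ρ k (a - 2) fun ε => pderiv1 i (pderiv1 i (F ε)) := fun i => by
    have := (hF.2.2 i).2.2 i
    rwa [show a - 1 - 1 = a - 2 by ring] at this
  exact (sum Finset.univ h).neg

theorem nlapIter (j : ℕ) (hF : ScaleBound ρ (2 * j) a F) :
    ScaleBound ρ 0 (a - 2 * j) fun ε => nlapIter j (F ε) := by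
  induction j generalizing a F with
  | zero =>
    rw [show a - 2 * ((0 : ℕ) : ℤ) = a by simp]
    exact hF
  | succ j ih =>
    have := ih (a := a - 2) (F := fun ε => _root_.nlap (F ε)) hF.nlap
    simp only [nlapIter_succ']
    rwa [show a - 2 - 2 * (j : ℤ) = a - 2 * ((j + 1 : ℕ) : ℤ) by push_cast; ring] at this

theorem comp_inv_smul {ζ : 𝔼 → ℝ} (hζ : ContDiff ℝ (⊤ : ℕ∞) ζ) (hc : HasCompactSupport ζ) :
    ScaleBound ρ k a fun ε y => ε ^ a * ζ (ε⁻¹ • y) := by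
  have hb : ∀ (a : ℤ) {ζ : 𝔼 → ℝ}, Continuous ζ → HasCompactSupport ζ →
      ∃ C : ℝ, ∀ ε, 0 < ε → ε ≤ ρ → ∀ y ∈ ball (0 : 𝔼) (5 * ε),
      |ε ^ a * ζ (ε⁻¹ • y)| ≤ C * ε ^ a := by
    intro a ζ hζ hc
    obtain ⟨C, hC⟩ := hc.exists_bound_of_continuous hζ
    refine ⟨C, fun ε h1 _ y _ => ?_⟩
    have := zpow_pos h1 a
    rw [abs_mul, abs_of_pos this, mul_comm]
    exact mul_le_mul_of_nonneg_right (hC _) this.le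
  induction k generalizing a ζ with
  | zero => exact hb a hζ.continuous hc
  | succ k ih =>
    have hd : Differentiable ℝ ζ := hζ.differentiable (by simp)
    refine ⟨fun ε _ _ y _ => ?_, hb a hζ.continuous hc, fun i => ?_⟩
    · exact (hd.comp (differentiable_id.const_smul ε⁻¹) y).const_mul _
    · refine (ih (a := a - 1) (pderiv1_contDiff hζ infty_add_one_le i)
        (hasCompactSupport_pderiv1 hc i)).congr fun ε h1 h2 y hy => ?_
      simp only
      rw [pderiv1_const_mul]
      simp only [pderiv1]
      rw [fderiv_comp_smul, zpow_sub_one₀ h1.ne']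
      simp only [_root_.smul_apply, smul_eq_mul]
      ring

theorem taylorRem {r : ℝ} (hρ : 5 * ρ < r) (hρ0 : 0 ≤ ρ) {N : ℕ} (hk : k ≤ N) {v : 𝔼 → ℝ}
    (hv : ContDiffOn ℝ (⊤ : ℕ∞) v (ball 0 r)) :
    ScaleBound ρ k (N : ℤ) fun _ => taylorRem N v := by
  have hb : ∀ (N : ℕ) {v : 𝔼 → ℝ}, ContDiffOn ℝ (⊤ : ℕ∞) v (ball 0 r) →
      ∃ C : ℝ, ∀ ε, 0 < ε → ε ≤ ρ → ∀ y ∈ ball (0 : 𝔼) (5 * ε),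
      |_root_.taylorRem N v y| ≤ C * ε ^ (N : ℤ) := by
    intro N v hv
    obtain ⟨C, hC0, hC⟩ := exists_taylorRem_bound hρ (by positivity) N hv
    refine ⟨C * 5 ^ N, fun ε h1 h2 y hy => ?_⟩
    rw [mem_ball_zero_iff] at hy
    refine (hC y (by rw [mem_closedBall_zero_iff]; linarith)).trans ?_
    rw [mul_assoc, zpow_natCast, ← mul_pow]
    exact mul_le_mul_of_nonneg_left (pow_le_pow_left₀ (norm_nonneg _) hy.le N) hC0
  induction k generalizing N v with
  | zero => exact hb N hv
  | succ k ih =>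
    obtain ⟨N, rfl⟩ := Nat.exists_eq_succ_of_ne_zero (by omega : N ≠ 0)
    have hsub : ∀ {ε}, ε ≤ ρ → ball (0 : 𝔼) (5 * ε) ⊆ ball 0 r := fun h2 =>
      ball_subset_ball (by linarith)
    refine ⟨fun ε h1 h2 y hy => ?_, hb _ hv, fun i => ?_⟩
    · exact ((contDiffOn_taylorRem _ hv).contDiffAt
        (isOpen_ball.mem_nhds (hsub h2 hy))).differentiableAt (by simp)
    · have := ih (N := N) (by omega) (pderiv1_contDiffOn isOpen_ball hv infty_add_one_le i)
      rw [show ((N.succ : ℕ) : ℤ) - 1 = N by push_cast; ring]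
      refine this.congr fun ε h1 h2 y hy => ?_
      exact pderiv1_taylorRem_succ isOpen_ball (mem_ball_self (by linarith)) N hv i (hsub h2 hy)

end ScaleBound

theorem exists_nlapIter_cutoff_mul_taylorRem_bound {r ρ : ℝ} (hρ : 5 * ρ < r) (hρ0 : 0 ≤ ρ) (m : ℕ)
    {ζ : 𝔼 → ℝ} (hζ : ContDiff ℝ (⊤ : ℕ∞) ζ) (hζs : tsupport ζ ⊆ closedBall 0 4) {v : 𝔼 → ℝ}
    (hv : ContDiffOn ℝ (⊤ : ℕ∞) v (ball 0 r)) :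
    ∃ C, ∀ ε, 0 < ε → ε ≤ ρ → ∀ y,
      |nlapIter m (fun y => ζ (ε⁻¹ • y) * taylorRem (2 * m) v y) y| ≤ C := by
  have hc : HasCompactSupport ζ :=
    (isCompact_closedBall (0 : 𝔼) 4).of_isClosed_subset (isClosed_tsupport _) hζs
  have h1 := (ScaleBound.comp_inv_smul (ρ := ρ) (k := 2 * m) (a := 0) hζ hc).mul
    (ScaleBound.taylorRem hρ hρ0 le_rfl hv)
  obtain ⟨C, hC⟩ := h1.nlapIter
  refine ⟨max C 0, fun ε h1 h2 y => ?_⟩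
  by_cases hy : y ∈ ball (0 : 𝔼) (5 * ε)
  · have := hC ε h1 h2 y hy
    simp only [zpow_zero, one_mul] at this
    refine this.trans (le_max_of_le_left ?_)
    simp
  · have hs : tsupport (nlapIter m (fun y => ζ (ε⁻¹ • y) * taylorRem (2 * m) v y))
        ⊆ closedBall 0 (4 * ε) := by
      refine (tsupport_nlapIter_subset m _).trans (closure_minimal (fun z hz => ?_) isClosed_closedBall)
      have h3 : ε⁻¹ • z ∈ tsupport ζ := subset_tsupport _ (left_ne_zero_of_mul hz)
      have h4 := hζs h3
      rw [mem_closedBall_zero_iff, norm_smul, norm_inv, Real.norm_of_nonneg h1.le,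
        inv_mul_le_iff₀ h1] at h4
      rw [mem_closedBall_zero_iff]
      linarith
    have hz : y ∉ tsupport (nlapIter m (fun y => ζ (ε⁻¹ • y) * taylorRem (2 * m) v y)) := by
      refine fun hc => hy ?_
      have := hs hc
      rw [mem_closedBall_zero_iff] at this
      rw [mem_ball_zero_iff]
      linarith
    rw [image_eq_zero_of_notMem_tsupport hz, abs_zero]
    exact le_max_right _ _

theorem mem_degLE {d : ℕ} {β : Fin n → ℕ} : β ∈ degLE n d ↔ ∑ i, β i ≤ d := by
  simp only [degLE, Finset.mem_filter, Fintype.mem_piFinset, Finset.mem_range]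
  refine ⟨fun h => h.2, fun h => ⟨fun i => ?_, h⟩⟩
  have := Finset.single_le_sum (f := β) (fun j _ => Nat.zero_le _) (Finset.mem_univ i)
  omega

section IteratedPartials

variable {U : Set (EuclideanSpace ℝ (Fin n))} {f g : EuclideanSpace ℝ (Fin n) → ℝ}

/-- The partial derivatives along the directions in `l`, with multiplicities `β`. -/
def listDeriv {n : ℕ} (β : Fin n → ℕ) (l : List (Fin n)) (f : EuclideanSpace ℝ (Fin n) → ℝ) :
    EuclideanSpace ℝ (Fin n) → ℝ :=
  (l.foldr (fun i F => F ∘ (pderiv1 i)^[β i]) id) f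

theorem pderiv1_iterate_eqOn (hU : IsOpen U) (h : EqOn f g U) (i : Fin n) (k : ℕ) :
    EqOn ((pderiv1 i)^[k] f) ((pderiv1 i)^[k] g) U := by
  induction k with
  | zero => exact h
  | succ k ih =>
    simp only [Function.iterate_succ_apply']
    exact pderiv1_eqOn hU ih i

theorem pderiv1_iterate_contDiffOn (hU : IsOpen U) (hf : ContDiffOn ℝ (⊤ : ℕ∞) f U) (i : Fin n)
    (k : ℕ) : ContDiffOn ℝ (⊤ : ℕ∞) ((pderiv1 i)^[k] f) U := by
  induction k with
  | zero => exact hf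
  | succ k ih =>
    simp only [Function.iterate_succ_apply']
    exact pderiv1_contDiffOn hU ih infty_add_one_le i

theorem pderiv1_iterate_comm (hU : IsOpen U) (hf : ContDiffOn ℝ (⊤ : ℕ∞) f U) (i j : Fin n)
    (k : ℕ) : EqOn ((pderiv1 i)^[k] (pderiv1 j f)) (pderiv1 j ((pderiv1 i)^[k] f)) U := by
  induction k with
  | zero => exact fun x _ => rfl
  | succ k ih =>
    simp only [Function.iterate_succ_apply']
    exact (pderiv1_eqOn hU ih i).trans (pderiv1_comm hU
      ((pderiv1_iterate_contDiffOn hU hf i k).of_le ENat.LEInfty.out) i j)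

theorem listDeriv_eqOn (hU : IsOpen U) (β : Fin n → ℕ) (l : List (Fin n)) (h : EqOn f g U) :
    EqOn (listDeriv β l f) (listDeriv β l g) U := by
  induction l generalizing f g with
  | nil => exact h
  | cons a l ih => exact ih (pderiv1_iterate_eqOn hU h a _)

theorem listDeriv_contDiffOn (hU : IsOpen U) (β : Fin n → ℕ) (l : List (Fin n))
    (hf : ContDiffOn ℝ (⊤ : ℕ∞) f U) : ContDiffOn ℝ (⊤ : ℕ∞) (listDeriv β l f) U := by
  induction l generalizing f with
  | nil => exact hf
  | cons a l ih => exact ih (pderiv1_iterate_contDiffOn hU hf a _)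

theorem listDeriv_pderiv1 (hU : IsOpen U) (β : Fin n → ℕ) (l : List (Fin n))
    (hf : ContDiffOn ℝ (⊤ : ℕ∞) f U) (i : Fin n) :
    EqOn (listDeriv β l (pderiv1 i f)) (pderiv1 i (listDeriv β l f)) U := by
  induction l generalizing f with
  | nil => exact fun x _ => rfl
  | cons a l ih =>
    exact (listDeriv_eqOn hU β l (pderiv1_iterate_comm hU hf a i _)).trans
      (ih (pderiv1_iterate_contDiffOn hU hf a _))

theorem listDeriv_add_single_of_notMem (β : Fin n → ℕ) (l : List (Fin n)) (i : Fin n) (hi : i ∉ l)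
    (f : EuclideanSpace ℝ (Fin n) → ℝ) :
    listDeriv (β + Pi.single i 1) l f = listDeriv β l f := by
  induction l generalizing f with
  | nil => rfl
  | cons a l ih =>
    rw [List.mem_cons, not_or] at hi
    have e : (β + Pi.single i 1 : Fin n → ℕ) a = β a := by
      simp [Pi.single_eq_of_ne' hi.1]
    change listDeriv (β + Pi.single i 1) l ((pderiv1 a)^[(β + Pi.single i 1 : Fin n → ℕ) a] f) = _
    rw [e, ih hi.2]
    rfl

theorem listDeriv_add_single (hU : IsOpen U) (β : Fin n → ℕ) (l : List (Fin n)) (hl : l.Nodup)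
    (i : Fin n) (hi : i ∈ l) (hf : ContDiffOn ℝ (⊤ : ℕ∞) f U) :
    EqOn (listDeriv (β + Pi.single i 1) l f) (pderiv1 i (listDeriv β l f)) U := by
  induction l generalizing f with
  | nil => simp at hi
  | cons a l ih =>
    rw [List.nodup_cons] at hl
    change EqOn (listDeriv (β + Pi.single i 1) l ((pderiv1 a)^[(β + Pi.single i 1 : Fin n → ℕ) a] f))
      (pderiv1 i (listDeriv β l ((pderiv1 a)^[β a] f))) U
    by_cases hai : i = a
    · subst hai
      have e : (β + Pi.single i 1 : Fin n → ℕ) i = β i + 1 := by simp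
      rw [e, listDeriv_add_single_of_notMem β l i hl.1, Function.iterate_succ_apply']
      exact listDeriv_pderiv1 hU β l (pderiv1_iterate_contDiffOn hU hf i _) i
    · have e : (β + Pi.single i 1 : Fin n → ℕ) a = β a := by
        simp [Pi.single_eq_of_ne' hai]
      rw [e]
      exact ih hl.2 ((List.mem_cons.1 hi).resolve_left hai) (pderiv1_iterate_contDiffOn hU hf a _)

theorem mderiv_contDiffOn (hU : IsOpen U) (β : Fin n → ℕ) (hf : ContDiffOn ℝ (⊤ : ℕ∞) f U) :
    ContDiffOn ℝ (⊤ : ℕ∞) (mderiv β f) U :=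
  listDeriv_contDiffOn hU β _ hf

theorem mderiv_add_single (hU : IsOpen U) (β : Fin n → ℕ) (i : Fin n)
    (hf : ContDiffOn ℝ (⊤ : ℕ∞) f U) :
    EqOn (mderiv (β + Pi.single i 1) f) (pderiv1 i (mderiv β f)) U :=
  listDeriv_add_single hU β _ (List.nodup_finRange n) i (List.mem_finRange i) hf

theorem nlapIter_pderiv1_iterate (hU : IsOpen U) (m k : ℕ) (i : Fin n)
    (hf : ContDiffOn ℝ (⊤ : ℕ∞) f U) (h0 : EqOn (nlapIter m f) 0 U) :
    EqOn (nlapIter m ((pderiv1 i)^[k] f)) 0 U := by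
  induction k with
  | zero => exact h0
  | succ k ih =>
    rw [Function.iterate_succ_apply']
    refine (nlapIter_pderiv1 hU (pderiv1_iterate_contDiffOn hU hf i k) i m).trans
      ((pderiv1_eqOn hU ih i).trans fun x _ => ?_)
    simp [pderiv1, fderiv_zero]

theorem nlapIter_mderiv (hU : IsOpen U) (m : ℕ) (β : Fin n → ℕ)
    (hf : ContDiffOn ℝ (⊤ : ℕ∞) f U) (h0 : EqOn (nlapIter m f) 0 U) :
    EqOn (nlapIter m (mderiv β f)) 0 U := by
  suffices h : ∀ (l : List (Fin n)) {f : EuclideanSpace ℝ (Fin n) → ℝ},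
      ContDiffOn ℝ (⊤ : ℕ∞) f U → EqOn (nlapIter m f) 0 U →
      EqOn (nlapIter m (listDeriv β l f)) 0 U from h _ hf h0
  intro l
  induction l with
  | nil => exact fun _ h => h
  | cons a l ih =>
    exact fun hf h0 => ih (pderiv1_iterate_contDiffOn hU hf a _)
      (nlapIter_pderiv1_iterate hU m _ a hf h0)

/-- The span, in the functions on `U`, of the derivatives of `f` of order at most `d`. -/
def mderivSpan {n : ℕ} (f : EuclideanSpace ℝ (Fin n) → ℝ) (U : Set (EuclideanSpace ℝ (Fin n)))
    (d : ℕ) : Submodule ℝ (U → ℝ) :=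
  Submodule.span ℝ ((fun β => U.domRestrict (mderiv β f)) '' (degLE n d : Set (Fin n → ℕ)))

theorem exists_coeff_of_mem_mderivSpan {d : ℕ} {F : U → ℝ} (h : F ∈ mderivSpan f U d) :
    ∃ a : (Fin n → ℕ) → ℝ, ∀ x : U, F x = ∑ β ∈ degLE n d, a β * mderiv β f x := by
  obtain ⟨a, ha⟩ := (Submodule.mem_span_image_finset_iff_exists_fun ℝ).1 h
  refine ⟨fun β => if h : β ∈ degLE n d then a ⟨β, h⟩ else 0, fun x => ?_⟩
  rw [← ha, ← Finset.sum_attach (degLE n d)]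
  simp

theorem mderivSpan_mono {d e : ℕ} (h : d ≤ e) : mderivSpan f U d ≤ mderivSpan f U e :=
  Submodule.span_mono (image_mono fun _ hβ => mem_degLE.2 ((mem_degLE.1 hβ).trans h))

theorem restrict_pderiv1_mem_mderivSpan (hU : IsOpen U) (hf : ContDiffOn ℝ (⊤ : ℕ∞) f U) {d : ℕ}
    (h : U.domRestrict g ∈ mderivSpan f U d) (i : Fin n) :
    U.domRestrict (pderiv1 i g) ∈ mderivSpan f U (d + 1) := by
  obtain ⟨a, ha⟩ := exists_coeff_of_mem_mderivSpan h
  have h1 : EqOn g (fun x => ∑ β ∈ degLE n d, a β * mderiv β f x) U := fun x hx => ha ⟨x, hx⟩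
  have e : U.domRestrict (pderiv1 i g) =
      ∑ β ∈ degLE n d, a β • U.domRestrict (mderiv (β + Pi.single i 1) f) := by
    funext x
    rw [Set.domRestrict_apply, pderiv1_eqOn hU h1 i x.2, pderiv1_sum fun β _ =>
      (((mderiv_contDiffOn hU β hf).contDiffAt (hU.mem_nhds x.2)).differentiableAt
        (by simp)).const_mul (a β)]
    simp [pderiv1_const_mul, mderiv_add_single hU _ i hf x.2]
  rw [e]
  refine Submodule.sum_mem _ fun β hβ => Submodule.smul_mem _ _ (Submodule.subset_span ⟨_, ?_, rfl⟩)
  refine mem_degLE.2 ?_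
  have := mem_degLE.1 hβ
  simpa [Finset.sum_add_distrib] using this

theorem integral_taylorTerm_mem_mderivSpan (hU : IsOpen U) (hf : ContDiffOn ℝ (⊤ : ℕ∞) f U)
    (k : ℕ) {d : ℕ} (h : U.domRestrict g ∈ mderivSpan f U d)
    {w : EuclideanSpace ℝ (Fin n) → ℝ} (hw : Continuous w) (hwc : HasCompactSupport w) :
    U.domRestrict (fun x => ∫ y, taylorTerm k (fun y => g (x - y)) y * w y) ∈
      mderivSpan f U (d + k) := by
  induction k generalizing g d w with
  | zero =>
    have e : U.domRestrict (fun x => ∫ y, taylorTerm 0 (fun y => g (x - y)) y * w y) =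
        (∫ y, w y) • U.domRestrict g := by
      funext x
      simp [taylorTerm, integral_const_mul, mul_comm]
    rw [e]
    exact Submodule.smul_mem _ _ h
  | succ k ih =>
    have hwi : ∀ i : Fin n, Continuous fun y : EuclideanSpace ℝ (Fin n) => y i * w y :=
      fun i => (by fun_prop : Continuous fun y : EuclideanSpace ℝ (Fin n) => y i).mul hw
    have e : U.domRestrict (fun x => ∫ y, taylorTerm (k + 1) (fun y => g (x - y)) y * w y) =
        ((k : ℝ) + 1)⁻¹ • ∑ i, U.domRestrict (fun x =>
          ∫ y, taylorTerm k (fun y => (fun z => -pderiv1 i g z) (x - y)) y * (y i * w y)) := by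
      funext x
      simp only [Set.domRestrict_apply, Pi.smul_apply, Finset.sum_apply, smul_eq_mul]
      rw [← integral_finsetSum (f := fun (i : Fin n) (y : EuclideanSpace ℝ (Fin n)) =>
          taylorTerm k (fun y => (fun z => -pderiv1 i g z) ((x : EuclideanSpace ℝ (Fin n)) - y)) y *
            (y i * w y)) _ fun i _ =>
        ((contDiff_taylorTerm (l := 0) k _).continuous.mul (hwi i)).integrable_of_hasCompactSupport
          (hwc.mul_left.mul_left), ← integral_const_mul]
      congr 1
      funext y
      simp only [taylorTerm, pderiv1_const_sub_comp, mul_assoc, Finset.sum_mul]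
      congr 1
      refine Finset.sum_congr rfl fun i _ => ?_
      ring
    rw [e]
    refine Submodule.smul_mem _ _ (Submodule.sum_mem _ fun i _ => ?_)
    rw [show d + (k + 1) = d + 1 + k by ring]
    exact ih (g := fun z => -pderiv1 i g z)
      (Submodule.neg_mem _ (restrict_pderiv1_mem_mderivSpan hU hf h i)) (hwi i) hwc.mul_left

end IteratedPartials

theorem contDiffOn_infty_of_nlapIter_eq_zero {m : ℕ} (hm : 0 < m) (hn : 2 * m ≤ n) {U : Set 𝔼}
    (hU : IsOpen U) {u : 𝔼 → ℝ} (hu : ContDiffOn ℝ (2 * m : ℕ) u U)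
    (h0 : ∀ x ∈ U, nlapIter m u x = 0) : ContDiffOn ℝ (⊤ : ℕ∞) u U := by
  intro x₀ hx₀
  obtain ⟨R, hR, hRU⟩ := Metric.isOpen_iff.1 hU x₀ hx₀
  let χ : ContDiffBump x₀ := ⟨R / 2, R * (3 / 4), by positivity, by linarith⟩
  have hχs : tsupport χ ⊆ U := by
    rw [χ.tsupport_eq]
    exact (closedBall_subset_ball (by change R * (3 / 4) < R; linarith)).trans hRU
  have hw := contDiff_mul_of_tsupport_subset (k := (2 * m : ℕ)) hU χ.contDiff hχs hu
  have hwc : HasCompactSupport fun y => χ y * u y := χ.hasCompactSupport.mul_right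
  obtain ⟨K, hK⟩ := exists_fundSol_representation hm hn (one_ne_zero (α := ℝ))
  have hw' : ContDiff ℝ ((0 + 2 * m : ℕ)) fun y => χ y * u y := by simpa using hw
  have hfc : Continuous (nlapIter m fun y => χ y * u y) :=
    (nlapIter_contDiff (k := 0) m hw').continuous
  have hpot := contDiffOn_potential (x₀ := x₀) (r := R / 4)
    (contDiffOn_fundSol (m := m) (n := n) (k := (⊤ : ℕ∞)) (one_ne_zero (α := ℝ))) hfc
    (hasCompactSupport_nlapIter m hwc) (by positivity) fun y hy => by
      have hy' : y ∈ ball x₀ (R / 2) := by convert hy using 2; ring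
      rw [nlapIter_eqOn isOpen_ball (fun z hz => ?_) m hy']
      · exact h0 y (hRU (ball_subset_ball (by linarith) hy'))
      · simp [χ.one_of_mem_closedBall (ball_subset_closedBall hz)]
  have hx : x₀ ∈ ball x₀ (R / 4) := mem_ball_self (by positivity)
  refine (((contDiffOn_const (c := K)).mul hpot).contDiffAt
    (isOpen_ball.mem_nhds hx)).congr_of_eventuallyEq ?_ |>.contDiffWithinAt
  filter_upwards [isOpen_ball.mem_nhds hx] with y hy
  rw [← hK _ hw hwc y, χ.one_of_mem_closedBall, one_mul]
  exact (ball_subset_closedBall.trans (closedBall_subset_closedBall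
    (by change R / 4 ≤ R / 2; linarith))) hy

/-- A smooth function equal to `1` for `‖y‖ ≤ ε` and to `0` for `‖y‖ ≥ 2ε`. -/
def cutoff (n : ℕ) (ε : ℝ) (y : EuclideanSpace ℝ (Fin n)) : ℝ :=
  (⟨1, 2, one_pos, one_lt_two⟩ : ContDiffBump (0 : EuclideanSpace ℝ (Fin n))) (ε⁻¹ • y)

section Cutoff

variable {ε : ℝ} {y : EuclideanSpace ℝ (Fin n)}

theorem contDiff_cutoff (ε : ℝ) : ContDiff ℝ (⊤ : ℕ∞) (cutoff n ε) :=
  (ContDiffBump.contDiff _).comp (contDiff_const_smul _)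

theorem cutoff_eq_one (hε : 0 < ε) (hy : ‖y‖ ≤ ε) : cutoff n ε y = 1 := by
  refine ContDiffBump.one_of_mem_closedBall _ ?_
  rw [mem_closedBall_zero_iff, norm_smul, norm_inv, Real.norm_of_nonneg hε.le]
  exact inv_mul_le_one_of_le₀ hy hε.le

theorem cutoff_eq_zero (hε : 0 < ε) (hy : 2 * ε ≤ ‖y‖) : cutoff n ε y = 0 := by
  refine ContDiffBump.zero_of_le_dist _ ?_
  rw [dist_zero_right, norm_smul, norm_inv, Real.norm_of_nonneg hε.le, ← div_eq_inv_mul]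
  exact (le_div_iff₀ hε).2 hy

theorem cutoff_nonneg : 0 ≤ cutoff n ε y := ContDiffBump.nonneg _

theorem cutoff_le_one : cutoff n ε y ≤ 1 := ContDiffBump.le_one _

theorem tsupport_cutoff_subset (hε : 0 < ε) : tsupport (cutoff n ε) ⊆ closedBall 0 (2 * ε) := by
  refine closure_minimal (fun y hy => ?_) isClosed_closedBall
  rw [mem_closedBall_zero_iff]
  by_contra! h
  exact hy (cutoff_eq_zero hε h.le)

theorem hasCompactSupport_cutoff (hε : 0 < ε) : HasCompactSupport (cutoff n ε) :=
  HasCompactSupport.of_support_subset_isCompact (isCompact_closedBall 0 (2 * ε))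
    (subset_closure.trans (tsupport_cutoff_subset hε))

theorem cutoff_mul (a ε : ℝ) (y : EuclideanSpace ℝ (Fin n)) :
    cutoff n (a * ε) y = cutoff n a (ε⁻¹ • y) := by
  simp [cutoff, smul_smul, mul_comm]

end Cutoff

/-- A smooth function equal to `1` for `2ε ≤ ‖y‖ ≤ 1/4`, vanishing for `‖y‖ ≤ ε` and for
`‖y‖ ≥ 1/2`. -/
def annulusCutoff (n : ℕ) (ε : ℝ) (y : EuclideanSpace ℝ (Fin n)) : ℝ :=
  cutoff n (1 / 4) y * (1 - cutoff n ε y)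

section AnnulusCutoff

variable {ε : ℝ} {y : EuclideanSpace ℝ (Fin n)}

theorem contDiff_annulusCutoff (ε : ℝ) : ContDiff ℝ (⊤ : ℕ∞) (annulusCutoff n ε) :=
  (contDiff_cutoff _).mul (contDiff_const.sub (contDiff_cutoff _))

theorem hasCompactSupport_annulusCutoff (ε : ℝ) : HasCompactSupport (annulusCutoff n ε) :=
  (hasCompactSupport_cutoff (by norm_num)).mul_right

theorem annulusCutoff_eq_one (hε : 0 < ε) (hy : 2 * ε ≤ ‖y‖) (hy' : ‖y‖ ≤ 1 / 4) :
    annulusCutoff n ε y = 1 := by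
  rw [annulusCutoff, cutoff_eq_zero hε hy, cutoff_eq_one (by norm_num) hy', sub_zero, one_mul]

theorem annulusCutoff_nonneg : 0 ≤ annulusCutoff n ε y :=
  mul_nonneg cutoff_nonneg (sub_nonneg.2 cutoff_le_one)

theorem annulusCutoff_le_one : annulusCutoff n ε y ≤ 1 :=
  mul_le_one₀ cutoff_le_one (sub_nonneg.2 cutoff_le_one) (sub_le_self _ cutoff_nonneg)

theorem tsupport_annulusCutoff_subset (hε : 0 < ε) :
    tsupport (annulusCutoff n ε) ⊆ ball 0 1 \ {0} := by
  refine subset_sdiff.2 ⟨(tsupport_mul_subset_left.trans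
    (tsupport_cutoff_subset (by norm_num))).trans (closedBall_subset_ball (by norm_num)), ?_⟩
  rw [disjoint_singleton_right, notMem_tsupport_iff_eventuallyEq]
  filter_upwards [ball_mem_nhds (0 : EuclideanSpace ℝ (Fin n)) hε] with y hy
  simp [annulusCutoff, cutoff_eq_one hε (mem_ball_zero_iff.1 hy).le]

end AnnulusCutoff

theorem natCast_le_infty (k : ℕ) : (k : WithTop ℕ∞) ≤ (⊤ : ℕ∞) :=
  ENat.LEInfty.out

theorem integrable_fundSol_sub_mul {m n : ℕ} (hm : 0 < m) (hn : 2 * m ≤ n) {c : ℝ} (hc : c ≠ 0)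
    {f : EuclideanSpace ℝ (Fin n) → ℝ} (hf : Continuous f) (hfc : HasCompactSupport f)
    (x : EuclideanSpace ℝ (Fin n)) : Integrable fun y => fundSol m n c (x - y) * f y := by
  have hfc' : HasCompactSupport fun y => f (x - y) :=
    hfc.comp_homeomorph (Homeomorph.subLeft x)
  simpa using (integrable_mul_of_locallyIntegrable (locallyIntegrable_fundSol hm hn hc)
    (hf.comp (continuous_const.sub continuous_id)) hfc').comp_sub_left x

theorem contDiffOn_fundSol_sub {m n : ℕ} {c : ℝ} (hc : c ≠ 0) (x : EuclideanSpace ℝ (Fin n)) :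
    ContDiffOn ℝ (⊤ : ℕ∞) (fun y => fundSol m n c (x - y)) (ball 0 ‖x‖) := by
  refine (contDiffOn_fundSol hc).comp (contDiff_const.sub contDiff_id).contDiffOn fun y hy h => ?_
  rw [mem_ball_zero_iff, ← sub_eq_zero.1 (mem_singleton_iff.1 h)] at hy
  exact lt_irrefl _ hy

section Punctured

variable {m : ℕ} {u : EuclideanSpace ℝ (Fin n) → ℝ} {ε : ℝ} {x y : EuclideanSpace ℝ (Fin n)}

/-- The function `(-Δ)^m (g u)`, where `g` is the cutoff to the annulus `ε < ‖y‖ < 1/2`. -/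
def cutoffSource {n : ℕ} (m : ℕ) (u : EuclideanSpace ℝ (Fin n) → ℝ) (ε : ℝ) :
    EuclideanSpace ℝ (Fin n) → ℝ :=
  nlapIter m fun y => annulusCutoff n ε y * u y

theorem isOpen_puncturedBall : IsOpen (ball (0 : EuclideanSpace ℝ (Fin n)) 1 \ {0}) :=
  isOpen_ball.sdiff isClosed_singleton

theorem contDiff_annulusCutoff_mul
    (hu : ContDiffOn ℝ (2 * m : ℕ) u (ball (0 : EuclideanSpace ℝ (Fin n)) 1 \ {0})) (hε : 0 < ε) :
    ContDiff ℝ (2 * m : ℕ) fun y => annulusCutoff n ε y * u y :=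
  contDiff_mul_of_tsupport_subset isOpen_puncturedBall
    ((contDiff_annulusCutoff ε).of_le (natCast_le_infty _)) (tsupport_annulusCutoff_subset hε) hu

theorem continuous_cutoffSource
    (hu : ContDiffOn ℝ (2 * m : ℕ) u (ball (0 : EuclideanSpace ℝ (Fin n)) 1 \ {0})) (hε : 0 < ε) :
    Continuous (cutoffSource m u ε) :=
  (nlapIter_contDiff (k := 0) m (by simpa using contDiff_annulusCutoff_mul hu hε)).continuous

theorem hasCompactSupport_cutoffSource (m : ℕ) (u : EuclideanSpace ℝ (Fin n) → ℝ) (ε : ℝ) :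
    HasCompactSupport (cutoffSource m u ε) :=
  hasCompactSupport_nlapIter m (hasCompactSupport_annulusCutoff ε).mul_right

theorem cutoffSource_eq_zero
    (h0 : ∀ x ∈ ball (0 : EuclideanSpace ℝ (Fin n)) 1 \ {0}, nlapIter m u x = 0) (hε : 0 < ε)
    (hy : 2 * ε < ‖y‖) (hy' : ‖y‖ < 1 / 4) : cutoffSource m u ε y = 0 := by
  have hO : IsOpen {z : EuclideanSpace ℝ (Fin n) | 2 * ε < ‖z‖ ∧ ‖z‖ < 1 / 4} :=
    (isOpen_lt continuous_const continuous_norm).inter (isOpen_lt continuous_norm continuous_const)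
  rw [cutoffSource, nlapIter_eqOn hO (fun z hz => ?_) m ⟨hy, hy'⟩]
  · exact h0 y ⟨mem_ball_zero_iff.2 (by linarith), fun h => by
      rw [mem_singleton_iff.1 h, norm_zero] at hy; linarith⟩
  · simp [annulusCutoff_eq_one hε hz.1.le hz.2.le]

theorem cutoffSource_eq {δ : ℝ} (hε : 0 < ε) (hεδ : ε ≤ δ) (hy : 2 * δ < ‖y‖) :
    cutoffSource m u ε y = cutoffSource m u δ y := by
  have hO : IsOpen {z : EuclideanSpace ℝ (Fin n) | 2 * δ < ‖z‖} :=
    isOpen_lt continuous_const continuous_norm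
  refine nlapIter_eqOn hO (fun z hz => ?_) m hy
  have hz : 2 * δ < ‖z‖ := hz
  simp only [annulusCutoff]
  rw [cutoff_eq_zero hε (by linarith), cutoff_eq_zero (hε.trans_le hεδ) hz.le]

/-- The part of the source away from the origin; for small `ε` it does not depend on `ε`. -/
theorem one_sub_cutoff_mul_cutoffSource
    (h0 : ∀ x ∈ ball (0 : EuclideanSpace ℝ (Fin n)) 1 \ {0}, nlapIter m u x = 0) {δ : ℝ}
    (hε : 0 < ε) (hεδ : ε ≤ δ) (hδ : 4 * δ < 1 / 4) (y : EuclideanSpace ℝ (Fin n)) :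
    (1 - cutoff n (2 * ε) y) * cutoffSource m u ε y =
      (1 - cutoff n (2 * δ) y) * cutoffSource m u δ y := by
  have key : ∀ {ε}, 0 < ε → ‖y‖ < 1 / 4 → (1 - cutoff n (2 * ε) y) * cutoffSource m u ε y = 0 := by
    intro ε hε hy
    rcases le_or_gt ‖y‖ (2 * ε) with h | h
    · rw [cutoff_eq_one (by positivity) h, sub_self, zero_mul]
    · rw [cutoffSource_eq_zero h0 hε h hy, mul_zero]
  have hδ0 := hε.trans_le hεδ
  rcases lt_or_ge ‖y‖ (1 / 4) with hy | hy
  · rw [key hε hy, key hδ0 hy]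
  · rw [cutoff_eq_zero (by positivity) (by linarith), cutoff_eq_zero (by positivity) (by linarith),
      cutoffSource_eq hε hεδ (by linarith)]

theorem one_sub_cutoff_mul_cutoffSource_eq_zero
    (h0 : ∀ x ∈ ball (0 : EuclideanSpace ℝ (Fin n)) 1 \ {0}, nlapIter m u x = 0) (hε : 0 < ε)
    (hy : ‖y‖ < 1 / 4) : (1 - cutoff n (2 * ε) y) * cutoffSource m u ε y = 0 := by
  rcases le_or_gt ‖y‖ (2 * ε) with h | h
  · rw [cutoff_eq_one (by positivity) h, sub_self, zero_mul]
  · rw [cutoffSource_eq_zero h0 hε h hy, mul_zero]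

open Filter Topology in
/-- The Taylor remainder of `y ↦ φ (x - y)` does not contribute in the limit `ε → 0`. -/
theorem tendsto_integral_taylorRem_mul_cutoffSource {c : ℝ} (hc : c ≠ 0)
    (hu : ContDiffOn ℝ (2 * m : ℕ) u (ball (0 : EuclideanSpace ℝ (Fin n)) 1 \ {0}))
    (hu_int : IntegrableOn u (ball (0 : EuclideanSpace ℝ (Fin n)) (1 / 4) \ {0})) (hx : x ≠ 0) :
    Tendsto (fun ε => ∫ y, taylorRem (2 * m) (fun y => fundSol m n c (x - y)) y *
      (cutoff n (2 * ε) y * cutoffSource m u ε y)) (𝓝[>] 0) (𝓝 0) := by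
  have hx0 : 0 < ‖x‖ := norm_pos_iff.2 hx
  set v : EuclideanSpace ℝ (Fin n) → ℝ := fun y => fundSol m n c (x - y)
  have hv : ContDiffOn ℝ (⊤ : ℕ∞) v (ball 0 ‖x‖) := contDiffOn_fundSol_sub hc x
  obtain ⟨C, hC⟩ := exists_nlapIter_cutoff_mul_taylorRem_bound (ρ := ‖x‖ / 6) (by linarith)
    (by positivity) m (contDiff_cutoff (n := n) 2)
    ((tsupport_cutoff_subset two_pos).trans (closedBall_subset_closedBall (by norm_num))) hv
  set J : EuclideanSpace ℝ (Fin n) → ℝ :=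
    (ball (0 : EuclideanSpace ℝ (Fin n)) (1 / 4) \ {0}).indicator fun y => |u y| with hJ
  have hJi : Integrable J := IntegrableOn.integrable_indicator hu_int.norm
    (isOpen_ball.sdiff isClosed_singleton).measurableSet
  have hJ0 : J 0 = 0 := indicator_of_notMem (by simp) _
  have hlim : Tendsto (fun ε : ℝ => C * ∫ y in closedBall 0 (4 * ε), J y) (𝓝[>] 0) (𝓝 0) := by
    suffices h : Tendsto (fun ε : ℝ => ∫ y in closedBall 0 (4 * ε), J y) (𝓝[>] 0) (𝓝 0) by
      simpa using h.const_mul C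
    simp only [← integral_indicator measurableSet_closedBall]
    rw [show (𝓝 (0 : ℝ)) = 𝓝 (∫ _ : EuclideanSpace ℝ (Fin n), (0 : ℝ)) by simp]
    refine tendsto_integral_filter_of_dominated_convergence (fun y => ‖J y‖)
      (Eventually.of_forall fun ε => (hJi.indicator measurableSet_closedBall).aestronglyMeasurable)
      (Eventually.of_forall fun ε => Eventually.of_forall fun y => norm_indicator_le_norm_self _ _)
      hJi.norm (Eventually.of_forall fun y => tendsto_const_nhds.congr' ?_)
    by_cases hy : y = 0
    · exact Eventually.of_forall fun ε => by
        change 0 = (closedBall 0 (4 * ε)).indicator J y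
        exact (indicator_apply_eq_zero.2 fun _ => by rw [hy, hJ0]).symm
    · have hy0 : 0 < ‖y‖ / 4 := by have := norm_pos_iff.2 hy; positivity
      filter_upwards [eventually_nhdsWithin_of_eventually_nhds (eventually_lt_nhds hy0)] with ε hε
      rw [indicator_of_notMem]
      rw [mem_closedBall_zero_iff]
      linarith
  refine squeeze_zero_norm' ?_ hlim
  have hsmall : ∀ᶠ ε : ℝ in 𝓝[>] 0, ε < min (‖x‖ / 6) (1 / 16) :=
    eventually_nhdsWithin_of_eventually_nhds (eventually_lt_nhds (by positivity))
  filter_upwards [hsmall, self_mem_nhdsWithin] with ε hεs hε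
  have hε : 0 < ε := hε
  obtain ⟨hε1, hε2⟩ := lt_min_iff.1 hεs
  set G : EuclideanSpace ℝ (Fin n) → ℝ := fun y => cutoff n (2 * ε) y * taylorRem (2 * m) v y
    with hG
  have hts : tsupport (cutoff n (2 * ε)) ⊆ closedBall 0 (4 * ε) := by
    convert tsupport_cutoff_subset (n := n) (ε := 2 * ε) (by positivity) using 2
    ring
  have hGd : ContDiff ℝ (⊤ : ℕ∞) G :=
    contDiff_mul_of_tsupport_subset isOpen_ball (contDiff_cutoff _)
      (hts.trans (closedBall_subset_ball (by linarith))) (contDiffOn_taylorRem _ hv)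
  have hGc : HasCompactSupport G := (hasCompactSupport_cutoff (by positivity)).mul_right
  have hGb : ∀ y, |nlapIter m G y| ≤ C := by
    convert hC ε hε hε1.le using 5
    simp only [hG, cutoff_mul]
  have hGs : ∀ y, y ∉ closedBall (0 : EuclideanSpace ℝ (Fin n)) (4 * ε) → nlapIter m G y = 0 :=
    fun y hy => image_eq_zero_of_notMem_tsupport fun h =>
      hy (hts (tsupport_mul_subset_left (tsupport_nlapIter_subset m G h)))
  have e : ∫ y, taylorRem (2 * m) v y * (cutoff n (2 * ε) y * cutoffSource m u ε y) =
      ∫ y, nlapIter m G y * (annulusCutoff n ε y * u y) := by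
    rw [← integral_mul_nlapIter isOpen_univ m (hGd.of_le (natCast_le_infty _)) hGc (subset_univ _)
      (contDiff_annulusCutoff_mul hu hε).contDiffOn]
    congr 1
    funext y
    simp only [hG, cutoffSource]
    ring
  rw [e, ← integral_const_mul, ← integral_indicator measurableSet_closedBall]
  refine norm_integral_le_of_norm_le ?_ (Eventually.of_forall fun y => ?_)
  · exact (hJi.const_mul C).indicator measurableSet_closedBall
  · by_cases hy : y ∈ closedBall (0 : EuclideanSpace ℝ (Fin n)) (4 * ε)
    · rw [indicator_of_mem hy]
      by_cases hy0 : y = 0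
      · have : annulusCutoff n ε y = 0 := by
          simp [annulusCutoff, cutoff_eq_one hε, hy0, hε.le]
        rw [this, hy0, hJ0]
        simp
      · have hym : y ∈ ball (0 : EuclideanSpace ℝ (Fin n)) (1 / 4) \ {0} :=
          ⟨mem_ball_zero_iff.2 ((mem_closedBall_zero_iff.1 hy).trans_lt (by linarith)), hy0⟩
        rw [hJ, indicator_of_mem hym, norm_mul, norm_mul]
        refine mul_le_mul (hGb y) ?_ (by positivity) ((abs_nonneg _).trans (hGb y))
        rw [Real.norm_of_nonneg annulusCutoff_nonneg]
        exact mul_le_of_le_one_left (norm_nonneg _) annulusCutoff_le_one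
    · simp [hGs y hy, indicator_of_notMem hy]

end Punctured

section PuncturedRepresentation

variable {m : ℕ} {u : EuclideanSpace ℝ (Fin n) → ℝ} {c K : ℝ}

open Filter Topology in
theorem sub_potential_mem_mderivSpan (hm : 0 < m) (hn : 2 * m ≤ n) (hc : c ≠ 0)
    (hK : ∀ w : EuclideanSpace ℝ (Fin n) → ℝ, ContDiff ℝ (2 * m : ℕ) w → HasCompactSupport w →
      ∀ x, w x = K * ∫ y, fundSol m n c (x - y) * nlapIter m w y)
    (hu : ContDiffOn ℝ (2 * m : ℕ) u (ball (0 : EuclideanSpace ℝ (Fin n)) 1 \ {0}))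
    (h0 : ∀ x ∈ ball (0 : EuclideanSpace ℝ (Fin n)) 1 \ {0}, nlapIter m u x = 0)
    (hu_int : IntegrableOn u (ball (0 : EuclideanSpace ℝ (Fin n)) (1 / 4) \ {0})) {δ : ℝ}
    (hδ : 0 < δ) (hδ' : 4 * δ < 1 / 4) :
    (ball (0 : EuclideanSpace ℝ (Fin n)) (1 / 4) \ {0}).domRestrict (fun x => u x -
        K * ∫ y, fundSol m n c (x - y) * ((1 - cutoff n (2 * δ) y) * cutoffSource m u δ y)) ∈
      mderivSpan (fundSol m n c) (ball (0 : EuclideanSpace ℝ (Fin n)) (1 / 4) \ {0})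
        (2 * m - 1) := by
  set V : Set (EuclideanSpace ℝ (Fin n)) := ball 0 (1 / 4) \ {0} with hV
  have hVo : IsOpen V := isOpen_ball.sdiff isClosed_singleton
  have hφ : ContDiffOn ℝ (⊤ : ℕ∞) (fundSol m n c) V :=
    (contDiffOn_fundSol hc).mono fun x hx => hx.2
  have hfin : FiniteDimensional ℝ (mderivSpan (fundSol m n c) V (2 * m - 1)) :=
    FiniteDimensional.span_of_finite ℝ ((Finset.finite_toSet _).image _)
  have hcl : IsClosed (mderivSpan (fundSol m n c) V (2 * m - 1) : Set (V → ℝ)) :=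
    Submodule.closed_of_finiteDimensional _
  let f : ℝ → EuclideanSpace ℝ (Fin n) → ℝ := fun ε y =>
    cutoff n (2 * ε) y * cutoffSource m u ε y
  have hf : ∀ ε, 0 < ε → Continuous (f ε) := fun ε hε =>
    (contDiff_cutoff _).continuous.mul (continuous_cutoffSource hu hε)
  have hfc : ∀ ε, HasCompactSupport (f ε) := fun ε =>
    (hasCompactSupport_cutoffSource m u ε).mul_left
  let S : ℝ → EuclideanSpace ℝ (Fin n) → ℝ := fun ε x =>
    K * ∑ k ∈ Finset.range (2 * m), ∫ y, taylorTerm k (fun y => fundSol m n c (x - y)) y * f ε y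
  have hbase : V.domRestrict (fundSol m n c) ∈ mderivSpan (fundSol m n c) V 0 := by
    refine Submodule.subset_span ⟨0, mem_degLE.2 (by simp), ?_⟩
    change V.domRestrict (listDeriv 0 (List.finRange n) (fundSol m n c)) = _
    congr 1
    generalize List.finRange n = l
    induction l with
    | nil => rfl
    | cons a l ih => exact ih
  have hS : ∀ ε, 0 < ε → V.domRestrict (S ε) ∈ mderivSpan (fundSol m n c) V (2 * m - 1) := by
    intro ε hε
    have e : V.domRestrict (S ε) = K • ∑ k ∈ Finset.range (2 * m), V.domRestrict fun x =>
        ∫ y, taylorTerm k (fun y => fundSol m n c (x - y)) y * f ε y := by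
      funext x
      simp [S]
    rw [e]
    refine Submodule.smul_mem _ _ (Submodule.sum_mem _ fun k hk => mderivSpan_mono ?_
      (integral_taylorTerm_mem_mderivSpan hVo hφ k hbase (hf ε hε) (hfc ε)))
    have := Finset.mem_range.1 hk
    omega
  refine hcl.mem_of_tendsto (f := fun ε => V.domRestrict (S ε)) (b := 𝓝[>] 0) ?_
    (eventually_nhdsWithin_of_forall fun ε hε => hS ε hε)
  refine tendsto_pi_nhds.2 fun x => ?_
  obtain ⟨x, hxV⟩ := x
  have hx0 : 0 < ‖x‖ := norm_pos_iff.2 hxV.2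
  have hlim := ((tendsto_integral_taylorRem_mul_cutoffSource hc hu hu_int hxV.2).const_mul
    K).const_sub (u x -
      K * ∫ y, fundSol m n c (x - y) * ((1 - cutoff n (2 * δ) y) * cutoffSource m u δ y))
  rw [mul_zero, sub_zero] at hlim
  refine hlim.congr' ?_
  have hsmall : ∀ᶠ ε : ℝ in 𝓝[>] 0, ε < min δ (‖x‖ / 2) :=
    eventually_nhdsWithin_of_eventually_nhds (eventually_lt_nhds (by positivity))
  filter_upwards [hsmall, self_mem_nhdsWithin] with ε hεs hε
  have hε : 0 < ε := hε
  obtain ⟨hε1, hε2⟩ := lt_min_iff.1 hεs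
  have h1 := hK _ (contDiff_annulusCutoff_mul hu hε) (hasCompactSupport_annulusCutoff ε).mul_right x
  rw [annulusCutoff_eq_one hε (by linarith) (mem_ball_zero_iff.1 hxV.1).le, one_mul] at h1
  have hI : ∀ {w : EuclideanSpace ℝ (Fin n) → ℝ}, Continuous w → HasCompactSupport w →
      Integrable fun y => fundSol m n c (x - y) * w y :=
    fun hw hwc => integrable_fundSol_sub_mul hm hn hc hw hwc x
  have hT : ∀ k, Integrable fun y =>
      taylorTerm k (fun y => fundSol m n c (x - y)) y * f ε y := fun k =>
    ((contDiff_taylorTerm (l := 0) k _).continuous.mul (hf ε hε)).integrable_of_hasCompactSupport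
      (hfc ε).mul_left
  have h2 : ∫ y, fundSol m n c (x - y) * cutoffSource m u ε y =
      (∫ y, fundSol m n c (x - y) * ((1 - cutoff n (2 * δ) y) * cutoffSource m u δ y)) +
        ∫ y, fundSol m n c (x - y) * f ε y := by
    simp only [← one_sub_cutoff_mul_cutoffSource h0 hε hε1.le hδ']
    rw [← integral_add (hI (w := fun y => (1 - cutoff n (2 * ε) y) * cutoffSource m u ε y)
      ((continuous_const.sub (contDiff_cutoff _).continuous).mul (continuous_cutoffSource hu hε))
      (hasCompactSupport_cutoffSource m u ε).mul_left) (hI (hf ε hε) (hfc ε))]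
    congr 1
    funext y
    simp only [f]
    ring
  have h3 : ∫ y, taylorRem (2 * m) (fun y => fundSol m n c (x - y)) y * f ε y =
      (∫ y, fundSol m n c (x - y) * f ε y) - ∑ k ∈ Finset.range (2 * m),
        ∫ y, taylorTerm k (fun y => fundSol m n c (x - y)) y * f ε y := by
    rw [← integral_finsetSum _ fun k _ => hT k, ← integral_sub (hI (hf ε hε) (hfc ε))
      (integrable_finsetSum _ fun k _ => hT k)]
    simp only [taylorRem, sub_mul, Finset.sum_mul]
  change u x - _ - K * ∫ y, taylorRem (2 * m) (fun y => fundSol m n c (x - y)) y * f ε y = S ε x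
  change u x = K * ∫ y, fundSol m n c (x - y) * cutoffSource m u ε y at h1
  rw [h3, h1, h2]
  simp only [S]
  ring

theorem contDiffOn_outer_potential (hc : c ≠ 0)
    (hu : ContDiffOn ℝ (2 * m : ℕ) u (ball (0 : EuclideanSpace ℝ (Fin n)) 1 \ {0}))
    (h0 : ∀ x ∈ ball (0 : EuclideanSpace ℝ (Fin n)) 1 \ {0}, nlapIter m u x = 0) {δ : ℝ}
    (hδ : 0 < δ) :
    ContDiffOn ℝ (⊤ : ℕ∞) (fun x => K * ∫ y, fundSol m n c (x - y) *
      ((1 - cutoff n (2 * δ) y) * cutoffSource m u δ y)) (ball 0 (1 / 8)) := by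
  refine contDiffOn_const.mul (contDiffOn_potential (contDiffOn_fundSol hc)
    ((continuous_const.sub (contDiff_cutoff _).continuous).mul (continuous_cutoffSource hu hδ))
    (hasCompactSupport_cutoffSource m u δ).mul_left (by norm_num) fun y hy => ?_)
  refine one_sub_cutoff_mul_cutoffSource_eq_zero h0 hδ ?_
  rw [mem_ball_zero_iff] at hy
  linarith

end PuncturedRepresentation

theorem nlapIter_sub_sum_eq_zero {U : Set 𝔼} (hU : IsOpen U) {ι : Type*} (s : Finset ι)
    {u : 𝔼 → ℝ} {F : ι → 𝔼 → ℝ} (a : ι → ℝ) (m : ℕ) (hu : ContDiffOn ℝ (2 * m : ℕ) u U)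
    (hF : ∀ i ∈ s, ContDiffOn ℝ (2 * m : ℕ) (F i) U) (hu0 : EqOn (nlapIter m u) 0 U)
    (hF0 : ∀ i ∈ s, EqOn (nlapIter m (F i)) 0 U) :
    EqOn (nlapIter m fun y => u y - ∑ i ∈ s, a i * F i y) 0 U := by
  classical
  induction s using Finset.induction_on with
  | empty => simpa using hu0
  | insert i s hi ih =>
    have hFi := hF i (Finset.mem_insert_self i s)
    have hFs := fun j hj => hF j (Finset.mem_insert_of_mem (a := j) (b := i) hj)
    have e : (fun y => u y - ∑ j ∈ insert i s, a j * F j y) =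
        fun y => (u y - ∑ j ∈ s, a j * F j y) - a i * F i y := by
      funext y
      rw [Finset.sum_insert hi]
      ring
    intro x hx
    rw [e, nlapIter_sub hU m (hu.sub (ContDiffOn.sum fun j hj => contDiffOn_const.mul (hFs j hj)))
      (contDiffOn_const.mul hFi) hx, nlapIter_const_mul]
    have h1 := ih hFs (fun j hj => hF0 j (Finset.mem_insert_of_mem hj)) hx
    have h2 := hF0 i (Finset.mem_insert_self i s) hx
    simp only [Pi.zero_apply] at h1 h2 ⊢
    rw [h1, h2, mul_zero, sub_zero]

end Preliminaries

/-- a classical solution of `(-Δ)^m u = 0` on the punctured unit ball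
with `u⁺ ∈ L¹` is `h + ∑_{|β| ≤ 2m-1} a_β D^β φ` with `h` polyharmonic in `B_1`. -/
theorem stmt_9 (m n : ℕ) (hm : 0 < m) (hn : 2*m ≤ n) (c : ℝ) (hc : 0 < c)
    (u : EuclideanSpace ℝ (Fin n) → ℝ)
    (hu : ContDiffOn ℝ (2*m : ℕ) u (ball (0 : EuclideanSpace ℝ (Fin n)) 1 \ {0}))
    (heq : ∀ x ∈ ball (0 : EuclideanSpace ℝ (Fin n)) 1 \ {0}, nlapIter m u x = 0)
    (huplus : IntegrableOn (fun x => max (u x) 0)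
      (ball (0 : EuclideanSpace ℝ (Fin n)) 1 \ {0})) :
    ∃ a : (Fin n → ℕ) → ℝ, ∃ h : EuclideanSpace ℝ (Fin n) → ℝ,
      ContDiffOn ℝ (⊤ : ℕ∞) h (ball (0 : EuclideanSpace ℝ (Fin n)) 1) ∧
      (∀ x ∈ ball (0 : EuclideanSpace ℝ (Fin n)) 1, nlapIter m h x = 0) ∧
      ∀ x ∈ ball (0 : EuclideanSpace ℝ (Fin n)) 1 \ {0},
        u x = h x + ∑ β ∈ degLE n (2*m - 1), a β * mderiv β (fundSol m n c) x := by
  have hn0 : 0 < n := by omega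
  have hc' : c ≠ 0 := hc.ne'
  have hO := isOpen_puncturedBall (n := n)
  obtain ⟨K, hK⟩ := exists_fundSol_representation hm hn hc'
  have hu_int := integrableOn_of_integrableOn_posPart (by omega) hu heq huplus
  have hδ : (0 : ℝ) < 1 / 32 := by norm_num
  obtain ⟨a, ha⟩ := exists_coeff_of_mem_mderivSpan
    (sub_potential_mem_mderivSpan hm hn hc' hK hu heq hu_int hδ (by norm_num))
  have hp := contDiffOn_outer_potential (K := K) hc' hu heq hδ
  set p : EuclideanSpace ℝ (Fin n) → ℝ := fun x => K * ∫ y, fundSol m n c (x - y) *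
    ((1 - cutoff n (2 * (1 / 32)) y) * cutoffSource m u (1 / 32) y)
  have hu' := contDiffOn_infty_of_nlapIter_eq_zero hm hn hO hu heq
  have hD : ∀ β, ContDiffOn ℝ (⊤ : ℕ∞) (mderiv β (fundSol m n c)) {0}ᶜ := fun β =>
    mderiv_contDiffOn isOpen_compl_singleton β (contDiffOn_fundSol hc')
  have hsub : ball (0 : EuclideanSpace ℝ (Fin n)) 1 \ {0} ⊆ {0}ᶜ := fun x hx => hx.2
  set H : EuclideanSpace ℝ (Fin n) → ℝ :=
    fun x => u x - ∑ β ∈ degLE n (2 * m - 1), a β * mderiv β (fundSol m n c) x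
  have hH : ContDiffOn ℝ (⊤ : ℕ∞) H (ball 0 1 \ {0}) :=
    hu'.sub (ContDiffOn.sum fun β _ => contDiffOn_const.mul ((hD β).mono hsub))
  have hH0 : EqOn (nlapIter m H) 0 (ball 0 1 \ {0}) :=
    nlapIter_sub_sum_eq_zero hO _ a m hu
      (fun β _ => ((hD β).mono hsub).of_le (natCast_le_infty _)) heq
      (fun β _ => (nlapIter_mderiv isOpen_compl_singleton m β (contDiffOn_fundSol hc')
        (nlapIter_fundSol hm hn hc')).mono hsub)
  let h : EuclideanSpace ℝ (Fin n) → ℝ := Function.update H 0 (p 0)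
  have hhH : EqOn h H (ball 0 1 \ {0}) := fun x hx => Function.update_of_ne hx.2 _ _
  have hhp : EqOn h p (ball 0 (1 / 8)) := by
    intro x hx
    by_cases hx0 : x = 0
    · rw [hx0]
      exact Function.update_self _ _ _
    · rw [show h x = H x from Function.update_of_ne hx0 _ _]
      have := ha ⟨x, ball_subset_ball (by norm_num) hx, hx0⟩
      simp only [domRestrict_apply] at this
      simp only [H, ← this]
      ring
  have hhs : ContDiffOn ℝ (⊤ : ℕ∞) h (ball 0 1) := by
    intro x hx
    by_cases hx0 : x = 0
    · have h0 : ball (0 : EuclideanSpace ℝ (Fin n)) (1 / 8) ∈ nhds x := by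
        rw [hx0]
        exact ball_mem_nhds _ (by norm_num)
      exact ((hp.congr hhp).contDiffAt h0).contDiffWithinAt
    · exact ((hH.congr hhH).contDiffAt (hO.mem_nhds ⟨hx, hx0⟩)).contDiffWithinAt
  have hh0 : EqOn (nlapIter m h) 0 (ball 0 1 \ {0}) := (nlapIter_eqOn hO hhH m).trans hH0
  refine ⟨a, h, hhs, fun x hx => ?_, fun x hx => ?_⟩
  · by_cases hx0 : x = 0
    · have : Nonempty (Fin n) := ⟨⟨0, hn0⟩⟩
      have hnb : (nhdsWithin x {x}ᶜ).NeBot := Module.punctured_nhds_neBot ℝ _ x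
      have hcont := ((nlapIter_contDiffOn_infty isOpen_ball m hhs).continuousOn.continuousAt
        (isOpen_ball.mem_nhds hx)).tendsto.mono_left (nhdsWithin_le_nhds (s := {x}ᶜ))
      refine tendsto_nhds_unique hcont (tendsto_const_nhds.congr' ?_)
      filter_upwards [self_mem_nhdsWithin, mem_nhdsWithin_of_mem_nhds (isOpen_ball.mem_nhds hx)]
        with y hy hy'
      exact (hh0 ⟨hy', by rwa [← hx0]⟩).symm
    · exact hh0 ⟨hx, hx0⟩
  · rw [hhH hx]
    simp only [H, sub_add_cancel]

end
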